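/- (Erdős–Gál law of the iterated logarithm) Let (n_k)_{k ≥ 1} be a sequence of positive integers satisfying the Hadamard gap condition n_{k+1}/n_k ≥ q for all k ≥ 1, for some q > 1. Then for Lebesgue-almost every x ∈ [0,1], limsup_{N → ∞} | ∑_{k=1}^N cos(2π n_k x) | / √(2 N log log N) = 1/√2. -/

import Mathlib

open MeasureTheory Filter Real

/-- Lebesgue measure on the unit interval. -/
noncomputable abbrev unitMeasure : Measure ℝ := volume.restrict (Set.Icc (0 : ℝ) 1)

instance : IsProbabilityMeasure unitMeasure := ⟨by simp⟩

lemma Continuous.integrable_unitMeasure {f : ℝ → ℝ} (hf : Continuous f) :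
    Integrable f unitMeasure :=
  hf.integrableOn_Icc

/-- The function `x ↦ cos (2πνx)`. -/
noncomputable def cosMode (ν : ℕ) : ℝ → ℝ := fun x => Real.cos (2 * π * ν * x)

lemma continuous_cosMode (ν : ℕ) : Continuous (cosMode ν) := by
  unfold cosMode; fun_prop

lemma abs_cosMode_le_one (ν : ℕ) (x : ℝ) : |cosMode ν x| ≤ 1 := Real.abs_cos_le_one _

lemma cosMode_mul_cosMode {a b : ℕ} (h : b ≤ a) :
    cosMode a * cosMode b = (1 / 2 : ℝ) • cosMode (a + b) + (1 / 2 : ℝ) • cosMode (a - b) := by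
  funext x
  simp only [cosMode, Pi.mul_apply, Pi.add_apply, Pi.smul_apply, smul_eq_mul]
  push_cast [h]
  rw [show 2 * π * ((a : ℝ) + b) * x = 2 * π * a * x + 2 * π * b * x by ring,
    show 2 * π * ((a : ℝ) - b) * x = 2 * π * a * x - 2 * π * b * x by ring,
    Real.cos_add, Real.cos_sub]
  ring

lemma integral_cosMode {ν : ℕ} (hν : ν ≠ 0) : ∫ x, cosMode ν x ∂unitMeasure = 0 := by
  rw [integral_Icc_eq_integral_Ioc, ← intervalIntegral.integral_of_le zero_le_one]
  have h : (2 * π * ν : ℝ) ≠ 0 := by positivity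
  unfold cosMode
  rw [intervalIntegral.integral_comp_mul_left (fun y => Real.cos y) h, integral_cos]
  have : Real.sin (2 * π * ν * 1) = 0 := by
    rw [show 2 * π * (ν : ℝ) * 1 = ((2 * ν : ℕ) : ℝ) * π by push_cast; ring]
    exact Real.sin_nat_mul_pi _
  rw [this]; simp

/-- The cosine polynomials all of whose frequencies lie in `P`. -/
noncomputable def cosSpan (P : Set ℕ) : Submodule ℝ (ℝ → ℝ) := Submodule.span ℝ (cosMode '' P)

lemma cosMode_mem_cosSpan {P : Set ℕ} {ν : ℕ} (h : ν ∈ P) : cosMode ν ∈ cosSpan P :=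
  Submodule.subset_span ⟨ν, h, rfl⟩

lemma cosSpan_mono {P Q : Set ℕ} (h : P ⊆ Q) : cosSpan P ≤ cosSpan Q :=
  Submodule.span_mono (Set.image_mono h)

lemma continuous_of_mem_cosSpan {P : Set ℕ} {f : ℝ → ℝ} (hf : f ∈ cosSpan P) :
    Continuous f := by
  induction hf using Submodule.span_induction with
  | mem f h => obtain ⟨ν, -, rfl⟩ := h; exact continuous_cosMode ν
  | zero => exact continuous_const
  | add f g _ _ hf hg => exact hf.add hg
  | smul c f _ hf => exact hf.const_smul c

lemma mul_mem_cosSpan {P Q S : Set ℕ}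
    (h : ∀ a ∈ P, ∀ b ∈ Q, cosMode a * cosMode b ∈ cosSpan S) {f g : ℝ → ℝ}
    (hf : f ∈ cosSpan P) (hg : g ∈ cosSpan Q) : f * g ∈ cosSpan S := by
  have hfg := Submodule.mul_mem_mul hf hg
  rw [cosSpan, cosSpan, Submodule.span_mul_span] at hfg
  refine Submodule.span_le.2 ?_ hfg
  rintro _ ⟨_, ⟨a, ha, rfl⟩, _, ⟨b, hb, rfl⟩, rfl⟩
  exact h a ha b hb

lemma cosMode_mul_cosMode_mem {S : Set ℕ} {a b : ℕ} (h₁ : a + b ∈ S)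
    (h₂ : (a - b) + (b - a) ∈ S) : cosMode a * cosMode b ∈ cosSpan S := by
  rcases le_total b a with h | h
  · rw [cosMode_mul_cosMode h]
    rw [Nat.sub_eq_zero_of_le h, add_zero] at h₂
    exact add_mem (Submodule.smul_mem _ _ (cosMode_mem_cosSpan h₁))
      (Submodule.smul_mem _ _ (cosMode_mem_cosSpan h₂))
  · rw [mul_comm, cosMode_mul_cosMode h]
    rw [Nat.sub_eq_zero_of_le h, zero_add] at h₂
    rw [add_comm] at h₁
    exact add_mem (Submodule.smul_mem _ _ (cosMode_mem_cosSpan h₁))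
      (Submodule.smul_mem _ _ (cosMode_mem_cosSpan h₂))

lemma mul_mem_cosSpan_le {D E : ℝ} {f g : ℝ → ℝ} (hf : f ∈ cosSpan {ν | (ν : ℝ) ≤ D})
    (hg : g ∈ cosSpan {ν | (ν : ℝ) ≤ E}) : f * g ∈ cosSpan {ν | (ν : ℝ) ≤ D + E} := by
  refine mul_mem_cosSpan (fun a ha b hb => ?_) hf hg
  have hab : ((a + b : ℕ) : ℝ) ≤ D + E := by push_cast; exact add_le_add ha hb
  refine cosMode_mul_cosMode_mem hab (le_trans ?_ hab)
  exact_mod_cast (by omega : a - b + (b - a) ≤ a + b)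

lemma integral_eq_zero_of_mem_cosSpan {P : Set ℕ} (hP : 0 ∉ P) {f : ℝ → ℝ}
    (hf : f ∈ cosSpan P) : ∫ x, f x ∂unitMeasure = 0 := by
  induction hf using Submodule.span_induction with
  | mem f h =>
    obtain ⟨ν, hν, rfl⟩ := h
    exact integral_cosMode fun h => hP (h ▸ hν)
  | zero => simp
  | add f g hf hg hf' hg' =>
    simp only [Pi.add_apply]
    rw [integral_add (continuous_of_mem_cosSpan hf).integrable_unitMeasure
      (continuous_of_mem_cosSpan hg).integrable_unitMeasure, hf', hg', add_zero]
  | smul c f _ hf => simp only [Pi.smul_apply, smul_eq_mul, integral_const_mul, hf, mul_zero]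

lemma integral_mul_eq_zero_of_mem_cosSpan {D E : ℝ} (hDE : D < E) {f g : ℝ → ℝ}
    (hf : f ∈ cosSpan {ν | (ν : ℝ) ≤ D}) (hg : g ∈ cosSpan {ν | E ≤ (ν : ℝ)}) :
    ∫ x, f x * g x ∂unitMeasure = 0 := by
  refine integral_eq_zero_of_mem_cosSpan (P := {ν | ν ≠ 0}) (by simp)
    (mul_mem_cosSpan (fun a ha b hb => ?_) hf hg)
  have hab : a < b := by
    have : (a : ℝ) < b := (lt_of_le_of_lt ha hDE).trans_le hb
    exact_mod_cast this
  exact cosMode_mul_cosMode_mem (by simp; omega) (by simp; omega)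

/-- A Hadamard lacunary sequence of positive integers. -/
structure Lacunary (q : ℝ) (a : ℕ → ℕ) : Prop where
  one_lt : 1 < q
  pos : ∀ k, 0 < a k
  gap : ∀ k, q * a k ≤ a (k + 1)

namespace Lacunary

variable {q : ℝ} {a : ℕ → ℕ}

lemma pow_mul_le (ha : Lacunary q a) {k l g : ℕ} (h : k + g ≤ l) : q ^ g * a k ≤ a l := by
  have h1 := ha.one_lt
  have key : ∀ d k, q ^ d * a k ≤ a (k + d) := by
    intro d
    induction d with
    | zero => simp
    | succ d ih =>
      intro k
      calc q ^ (d + 1) * a k = q * (q ^ d * a k) := by ring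
        _ ≤ q * a (k + d) := by gcongr; exact ih k
        _ ≤ a (k + (d + 1)) := ha.gap _
  calc q ^ g * a k ≤ q ^ (l - k) * a k := by gcongr; exacts [h1.le, by omega]
    _ ≤ a l := by simpa [show k + (l - k) = l by omega] using key (l - k) k

lemma monotone (ha : Lacunary q a) {k l : ℕ} (h : k ≤ l) : (a k : ℝ) ≤ a l := by
  simpa using ha.pow_mul_le (g := 0) h

lemma sub_ge (ha : Lacunary q a) {k l : ℕ} (h : k < l) :
    (1 - 1 / q) * a l ≤ (a l : ℝ) - a k := by
  have h1 := ha.one_lt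
  have h2 := ha.pow_mul_le (g := 1) h
  have : (a k : ℝ) ≤ 1 / q * a l := by
    rw [one_div, ← div_eq_inv_mul, le_div_iff₀ (by linarith)]; linarith
  linarith

end Lacunary

/-- The cosine polynomial `∑ k ∈ I, c k * cos (2π (a k) x)`. -/
noncomputable def cosSum (a : ℕ → ℕ) (c : ℕ → ℝ) (I : Finset ℕ) : ℝ → ℝ :=
  fun x => ∑ k ∈ I, c k * cosMode (a k) x

lemma continuous_cosSum (a : ℕ → ℕ) (c : ℕ → ℝ) (I : Finset ℕ) : Continuous (cosSum a c I) :=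
  continuous_finsetSum _ fun _ _ => (continuous_cosMode _).const_mul _

lemma cosSum_eq_sum_smul (a : ℕ → ℕ) (c : ℕ → ℝ) (I : Finset ℕ) :
    cosSum a c I = ∑ k ∈ I, c k • cosMode (a k) := by
  funext x; simp [cosSum]

lemma Lacunary.cosSum_quadratic_mem {q : ℝ} {a : ℕ → ℕ} (ha : Lacunary q a) (c : ℕ → ℝ)
    (B : Finset ℕ) {l : ℕ} (hl : ∀ k ∈ B, l ≤ k) {M : ℝ} (hM : ∀ k ∈ B, (a k : ℝ) ≤ M) :
    (fun x => cosSum a c B x + cosSum a c B x ^ 2 / 2 - (∑ k ∈ B, c k ^ 2) / 4) ∈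
      cosSpan {ν | (1 - 1 / q) * a l ≤ (ν : ℝ) ∧ (ν : ℝ) ≤ 2 * M} := by
  set P : Set ℕ := {ν | (1 - 1 / q) * a l ≤ (ν : ℝ) ∧ (ν : ℝ) ≤ 2 * M}
  have hq := ha.one_lt
  have hq0 : 0 ≤ 1 - 1 / q := by
    rw [sub_nonneg, div_le_one (by linarith)]; exact hq.le
  have hq1 : 1 - 1 / q ≤ 1 := by
    have : 0 ≤ 1 / q := by positivity
    linarith
  have hlk : ∀ k ∈ B, (1 - 1 / q) * a l ≤ a k := fun k hk =>
    (mul_le_of_le_one_left (by positivity) hq1).trans (ha.monotone (hl k hk))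
  have h1 : cosSum a c B ∈ cosSpan P := by
    rw [cosSum_eq_sum_smul]
    refine sum_mem fun k hk => Submodule.smul_mem _ _ (cosMode_mem_cosSpan ⟨hlk k hk, ?_⟩)
    have := hM k hk
    have : (0 : ℝ) ≤ a k := by positivity
    linarith
  have h2 : cosSum a c B * cosSum a c B - (fun _ => (∑ k ∈ B, c k ^ 2) / 2) ∈ cosSpan P := by
    have : cosSum a c B * cosSum a c B - (fun _ => (∑ k ∈ B, c k ^ 2) / 2) =
        ∑ k ∈ B, ∑ j ∈ B, (c k * c j) •
          (cosMode (a k) * cosMode (a j) - fun _ => if k = j then 1 / 2 else 0) := by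
      funext x
      simp only [Pi.sub_apply, Pi.mul_apply, cosSum, Finset.sum_mul_sum, Finset.sum_apply,
        Pi.smul_apply, smul_eq_mul, mul_sub, Finset.sum_sub_distrib]
      congr 1
      · exact Finset.sum_congr rfl fun k _ => Finset.sum_congr rfl fun j _ => by ring
      · rw [Finset.sum_div]
        refine Finset.sum_congr rfl fun k hk => ?_
        simp [hk]; ring
    rw [this]
    refine sum_mem fun k hk => sum_mem fun j hj => Submodule.smul_mem _ _ ?_
    have hadd : a k + a j ∈ P := by
      refine ⟨?_, ?_⟩
      · push_cast
        have := hlk k hk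
        have : (0 : ℝ) ≤ a j := by positivity
        linarith
      · push_cast; linarith [hM k hk, hM j hj]
    by_cases hkj : k = j
    · subst hkj
      have : (cosMode (a k) * cosMode (a k) - fun _ => if k = k then (1 / 2 : ℝ) else 0) =
          (1 / 2 : ℝ) • cosMode (a k + a k) := by
        rw [cosMode_mul_cosMode le_rfl]
        funext x
        simp [cosMode]
      rw [this]
      exact Submodule.smul_mem _ _ (cosMode_mem_cosSpan hadd)
    · have : (cosMode (a k) * cosMode (a j) - fun _ => if k = j then (1 / 2 : ℝ) else 0) =
          cosMode (a k) * cosMode (a j) := by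
        funext x; simp [hkj]
      rw [this]
      refine cosMode_mul_cosMode_mem hadd ⟨?_, le_trans ?_ hadd.2⟩
      · have key : ∀ i j, l ≤ i → i < j →
            (1 - 1 / q) * a l ≤ ((a j - a i + (a i - a j) : ℕ) : ℝ) := by
          intro i j hi hij
          have h := ha.sub_ge hij
          have hle : a i ≤ a j := by exact_mod_cast ha.monotone hij.le
          rw [Nat.sub_eq_zero_of_le hle, add_zero, Nat.cast_sub hle]
          refine le_trans ?_ h
          gcongr
          exact_mod_cast ha.monotone (hi.trans hij.le)
        rcases lt_or_gt_of_ne hkj with h | h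
        · rw [add_comm]; exact key _ _ (hl k hk) h
        · exact key _ _ (hl j hj) h
      · exact_mod_cast (by omega : a k - a j + (a j - a k) ≤ a k + a j)
  have : (fun x => cosSum a c B x + cosSum a c B x ^ 2 / 2 - (∑ k ∈ B, c k ^ 2) / 4) =
      cosSum a c B + (1 / 2 : ℝ) •
        (cosSum a c B * cosSum a c B - (fun _ => (∑ k ∈ B, c k ^ 2) / 2)) := by
    funext x; simp; ring
  rw [this]
  exact add_mem h1 (Submodule.smul_mem _ _ h2)

lemma const_mem_cosSpan {D : ℝ} (hD : 0 ≤ D) (r : ℝ) :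
    (fun _ => r) ∈ cosSpan {ν | (ν : ℝ) ≤ D} := by
  have : (fun _ => r) = r • cosMode 0 := by funext x; simp [cosMode]
  rw [this]
  exact Submodule.smul_mem _ _ (cosMode_mem_cosSpan (by simpa using hD))

/-- The quadratic Taylor polynomial of `exp`. -/
noncomputable def quadExp (u : ℝ) : ℝ := 1 + u + u ^ 2 / 2

lemma continuous_quadExp : Continuous quadExp := by unfold quadExp; fun_prop

lemma quadExp_pos (u : ℝ) : 0 < quadExp u := by
  unfold quadExp; nlinarith [sq_nonneg (u + 1)]

theorem Lacunary.integral_prod_quadExp {q : ℝ} {a : ℕ → ℕ} (ha : Lacunary q a) {g : ℕ}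
    (hg : 4 < q ^ g * (1 - 1 / q)) (c : ℕ → ℝ) (B : ℕ → Finset ℕ)
    (hB : ∀ i j, i < j → ∀ k ∈ B i, ∀ l ∈ B j, k + g ≤ l) (s : Finset ℕ) :
    ∫ x, ∏ i ∈ s, quadExp (cosSum a c (B i) x) ∂unitMeasure =
      ∏ i ∈ s, (1 + (∑ k ∈ B i, c k ^ 2) / 4) := by
  have hq := ha.one_lt
  have hqg : 4 < q ^ g := by
    refine hg.trans_le (mul_le_of_le_one_right (by positivity) ?_)
    have : 0 ≤ 1 / q := by positivity
    linarith
  suffices H : (∀ D : ℝ, 0 ≤ D → (∀ i ∈ s, ∀ k ∈ B i, 4 * (a k : ℝ) ≤ D) →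
      (∏ i ∈ s, fun x => quadExp (cosSum a c (B i) x)) ∈ cosSpan {ν | (ν : ℝ) ≤ D}) ∧
      ∫ x, ∏ i ∈ s, quadExp (cosSum a c (B i) x) ∂unitMeasure =
      ∏ i ∈ s, (1 + (∑ k ∈ B i, c k ^ 2) / 4) from H.2
  induction s using Finset.induction_on_max with
  | empty => exact ⟨fun D hD _ => const_mem_cosSpan hD 1, by simp⟩
  | insert i s hi ih =>
    have his : i ∉ s := fun h => lt_irrefl _ (hi i h)
    rw [Finset.prod_insert his, Finset.prod_insert his]
    simp only [Finset.prod_insert his]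
    rcases (B i).eq_empty_or_nonempty with hBi | hBi
    · have h1 : (fun x => quadExp (cosSum a c (B i) x)) = 1 := by
        funext x; simp [hBi, cosSum, quadExp]
      have h2 : ∀ x, quadExp (cosSum a c (B i) x) = 1 := fun x => congrFun h1 x
      refine ⟨fun D hD h => ?_, ?_⟩
      · rw [h1, one_mul]
        exact ih.1 D hD fun j hj => h j (Finset.mem_insert_of_mem hj)
      · simp only [h2, one_mul]
        simp only [hBi, one_mul, Finset.sum_empty, zero_div, add_zero]
        exact ih.2
    set l := (B i).min' hBi
    set r := (∑ k ∈ B i, c k ^ 2) / 4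
    have hlB : l ∈ B i := Finset.min'_mem _ _
    have hlow : ∀ j ∈ s, ∀ k ∈ B j, 4 * (a k : ℝ) ≤ 4 / q ^ g * a l := fun j hj k hk => by
      have := ha.pow_mul_le (hB j i (hi j hj) k hk l hlB)
      rw [div_mul_eq_mul_div, le_div_iff₀ (by positivity)]
      linarith
    have hmem : ∀ M : ℝ, (∀ k ∈ B i, (a k : ℝ) ≤ M) → _ := fun M hM =>
      ha.cosSum_quadratic_mem c (B i) (l := l) (fun k hk => Finset.min'_le _ _ hk) hM
    have hquad : (fun x => quadExp (cosSum a c (B i) x)) = (fun _ => 1 + r) +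
        fun x => cosSum a c (B i) x + cosSum a c (B i) x ^ 2 / 2 - r := by
      funext x; simp [quadExp]; ring
    refine ⟨fun D hD h => ?_, ?_⟩
    · have hM : ∀ k ∈ B i, (a k : ℝ) ≤ D / 4 := fun k hk => by
        linarith [h i (Finset.mem_insert_self _ _) k hk]
      have h1 := ih.1 (D / 2) (by linarith) fun j hj k hk => by
        have h1 := hlow j hj k hk
        have h2 : 4 / q ^ g * (a l : ℝ) ≤ 1 * a l := by
          gcongr; rw [div_le_one (by positivity)]; exact hqg.le
        linarith [hM l hlB]
      have h2 : (fun x => quadExp (cosSum a c (B i) x)) ∈ cosSpan {ν | (ν : ℝ) ≤ D / 2} := by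
        rw [hquad]
        refine add_mem (const_mem_cosSpan (by linarith) _)
          (cosSpan_mono (fun ν hν => ?_) (hmem _ hM))
        have := hν.2
        simp only [Set.mem_ofPred_eq]
        linarith
      have := mul_mem_cosSpan_le h2 h1
      rwa [add_halves] at this
    · have hP := ih.1 (4 / q ^ g * a l) (by positivity) hlow
      set Pf := ∏ j ∈ s, fun x => quadExp (cosSum a c (B j) x) with hPf
      have hPx : ∀ x, ∏ j ∈ s, quadExp (cosSum a c (B j) x) = Pf x := fun x => by
        simp [hPf]
      have hG := hmem (∑ k ∈ B i, (a k : ℝ)) fun k hk =>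
        Finset.single_le_sum (f := fun k => (a k : ℝ)) (fun _ _ => by positivity) hk
      set G := fun x => cosSum a c (B i) x + cosSum a c (B i) x ^ 2 / 2 - r with hGdef
      have hlt : 4 / q ^ g * (a l : ℝ) < (1 - 1 / q) * a l := by
        have := ha.pos l
        gcongr
        rw [div_lt_iff₀ (by positivity)]; linarith
      have h0 := integral_mul_eq_zero_of_mem_cosSpan hlt hP
        (cosSpan_mono (fun ν hν => hν.1) hG)
      have hx : ∀ x, quadExp (cosSum a c (B i) x) = 1 + r + G x := fun x => congrFun hquad x
      have hPc := continuous_of_mem_cosSpan hP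
      have hGc := continuous_of_mem_cosSpan hG
      simp only [hPx, hx, add_mul _ (G _)] at ih ⊢
      rw [integral_add (hPc.const_mul _ ).integrable_unitMeasure
        (Continuous.integrable_unitMeasure (f := fun x => G x * Pf x) (hGc.mul hPc)),
        integral_const_mul, ih.2]
      simp only [mul_comm (G _), h0, add_zero]

lemma exp_sub_quadExp_le {u : ℝ} (hu : |u| ≤ 1) : |exp u - quadExp u| ≤ |u| ^ 3 * (2 / 9) := by
  have := Real.exp_bound hu (n := 3) (by norm_num)
  norm_num [Finset.sum_range_succ, Nat.factorial] at this
  simpa [quadExp] using this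

lemma exp_le_quadExp_mul_exp {u : ℝ} (hu : |u| ≤ 1) :
    exp u ≤ quadExp u * exp (|u| ^ 3) := by
  have h1 := (abs_le.1 (exp_sub_quadExp_le hu)).2
  have h2 := add_one_le_exp (|u| ^ 3)
  have h3 : 1 / 2 ≤ quadExp u := by unfold quadExp; nlinarith [sq_nonneg (u + 1)]
  have h4 : 0 ≤ |u| ^ 3 := by positivity
  calc exp u ≤ quadExp u * (|u| ^ 3 + 1) := by nlinarith
    _ ≤ _ := by gcongr

lemma quadExp_le_exp {u : ℝ} (hu : |u| ≤ 1) : quadExp u ≤ exp (u + |u| ^ 3) := by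
  have h1 := (abs_le.1 (exp_sub_quadExp_le hu)).1
  have h2 := add_one_le_exp (|u| ^ 3)
  have h4 : 0 ≤ |u| ^ 3 := by positivity
  have h5 : 1 / 3 ≤ exp u := by
    have h6 : exp (-1) ≤ exp u := exp_le_exp.2 (abs_le.1 hu).1
    have h7 : 1 / 3 ≤ exp (-1) := by
      rw [exp_neg, one_div]
      exact inv_anti₀ (exp_pos _) (by linarith [exp_one_lt_d9])
    linarith
  rw [exp_add]
  calc quadExp u ≤ exp u * (|u| ^ 3 + 1) := by nlinarith
    _ ≤ _ := by gcongr

lemma abs_cosSum_le (a : ℕ → ℕ) (c : ℕ → ℝ) (I : Finset ℕ) (x : ℝ) :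
    |cosSum a c I x| ≤ ∑ k ∈ I, |c k| := by
  refine (Finset.abs_sum_le_sum_abs _ _).trans (Finset.sum_le_sum fun k _ => ?_)
  rw [abs_mul]
  exact mul_le_of_le_one_right (abs_nonneg _) (abs_cosMode_le_one _ _)

lemma abs_cosSum_le_card_mul (a : ℕ → ℕ) {c : ℕ → ℝ} {I : Finset ℕ} {H : ℕ} {b : ℝ} (hb : 0 ≤ b)
    (hH : I.card ≤ H) (hc : ∀ k ∈ I, |c k| ≤ b) (x : ℝ) : |cosSum a c I x| ≤ H * b := by
  refine (abs_cosSum_le a c I x).trans ((Finset.sum_le_card_nsmul _ _ _ hc).trans ?_)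
  rw [nsmul_eq_mul]; gcongr

lemma abs_cosSum_pow_three_le (a : ℕ → ℕ) {c : ℕ → ℝ} {I : Finset ℕ} {H : ℕ} {b : ℝ}
    (hb : 0 ≤ b) (hH : I.card ≤ H) (hc : ∀ k ∈ I, |c k| ≤ b) (x : ℝ) :
    |cosSum a c I x| ^ 3 ≤ H ^ 2 * b * ∑ k ∈ I, c k ^ 2 := by
  have h1 := abs_cosSum_le_card_mul a hb hH hc x
  have h2 : |cosSum a c I x| ^ 2 ≤ H * ∑ k ∈ I, c k ^ 2 := by
    calc |cosSum a c I x| ^ 2 ≤ (∑ k ∈ I, |c k|) ^ 2 := by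
          gcongr; exact abs_cosSum_le a c I x
      _ ≤ I.card * ∑ k ∈ I, |c k| ^ 2 := sq_sum_le_card_mul_sum_sq
      _ ≤ H * ∑ k ∈ I, c k ^ 2 := by simp only [sq_abs]; gcongr
  calc |cosSum a c I x| ^ 3 = |cosSum a c I x| ^ 2 * |cosSum a c I x| := by ring
    _ ≤ (H * ∑ k ∈ I, c k ^ 2) * (H * b) := by gcongr
    _ = _ := by ring

theorem Lacunary.integral_exp_sum_blocks_le {q : ℝ} {a : ℕ → ℕ} (ha : Lacunary q a) {g : ℕ}
    (hg : 4 < q ^ g * (1 - 1 / q)) (c : ℕ → ℝ) (B : ℕ → Finset ℕ)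
    (hB : ∀ i j, i < j → ∀ k ∈ B i, ∀ l ∈ B j, k + g ≤ l) (s : Finset ℕ) {H : ℕ} {b : ℝ}
    (hb : 0 ≤ b) (hH : ∀ i ∈ s, (B i).card ≤ H) (hc : ∀ i ∈ s, ∀ k ∈ B i, |c k| ≤ b)
    (hHb : H * b ≤ 1) :
    ∫ x, exp (∑ i ∈ s, cosSum a c (B i) x) ∂unitMeasure ≤
      exp ((1 / 4 + H ^ 2 * b) * ∑ i ∈ s, ∑ k ∈ B i, c k ^ 2) := by
  have hcont : Continuous fun x => ∏ i ∈ s, quadExp (cosSum a c (B i) x) :=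
    continuous_finsetProd _ fun i _ => continuous_quadExp.comp (continuous_cosSum a c (B i))
  have hpt : ∀ x, exp (∑ i ∈ s, cosSum a c (B i) x) ≤
      exp (H ^ 2 * b * ∑ i ∈ s, ∑ k ∈ B i, c k ^ 2) *
        ∏ i ∈ s, quadExp (cosSum a c (B i) x) := fun x => by
    rw [exp_sum, Finset.mul_sum, exp_sum, ← Finset.prod_mul_distrib]
    refine Finset.prod_le_prod (fun i _ => (exp_pos _).le) fun i hi => ?_
    refine (exp_le_quadExp_mul_exp
      ((abs_cosSum_le_card_mul a hb (hH i hi) (hc i hi) x).trans hHb)).trans ?_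
    rw [mul_comm]
    gcongr
    · exact (quadExp_pos _).le
    · exact abs_cosSum_pow_three_le a hb (hH i hi) (hc i hi) x
  calc ∫ x, exp (∑ i ∈ s, cosSum a c (B i) x) ∂unitMeasure
      ≤ ∫ x, exp (H ^ 2 * b * ∑ i ∈ s, ∑ k ∈ B i, c k ^ 2) *
        ∏ i ∈ s, quadExp (cosSum a c (B i) x) ∂unitMeasure :=
        integral_mono (Continuous.integrable_unitMeasure (continuous_exp.comp
          (continuous_finsetSum _ fun i _ => continuous_cosSum a c (B i))))
          (Continuous.integrable_unitMeasure (hcont.const_mul _)) hpt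
    _ = exp (H ^ 2 * b * ∑ i ∈ s, ∑ k ∈ B i, c k ^ 2) *
        ∏ i ∈ s, (1 + (∑ k ∈ B i, c k ^ 2) / 4) := by
        rw [integral_const_mul, ha.integral_prod_quadExp hg c B hB s]
    _ ≤ exp (H ^ 2 * b * ∑ i ∈ s, ∑ k ∈ B i, c k ^ 2) *
        ∏ i ∈ s, exp ((∑ k ∈ B i, c k ^ 2) / 4) := by
        gcongr with i _
        linarith [add_one_le_exp ((∑ k ∈ B i, c k ^ 2) / 4)]
    _ = _ := by
        rw [← exp_sum, ← exp_add, ← Finset.sum_div]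
        congr 1; ring

lemma card_filter_le_add_mod (H g k : ℕ) :
    ((Finset.range H).filter fun s => g ≤ (k + s) % H).card = H - g := by
  have h1 := Nat.filter_Ico_card_eq_of_periodic k H (fun m => g ≤ m % H)
    (fun m => by simp)
  rw [Nat.count_eq_card_filter_range] at h1
  have h2 : (Finset.range H).filter (fun m => g ≤ m % H) = Finset.Ico g H := by
    ext m
    simp only [Finset.mem_filter, Finset.mem_range, Finset.mem_Ico]
    constructor
    · rintro ⟨h, h'⟩; rw [Nat.mod_eq_of_lt h] at h'; exact ⟨h', h⟩
    · rintro ⟨h, h'⟩; rw [Nat.mod_eq_of_lt h']; exact ⟨h', h⟩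
  rw [h2, Nat.card_Ico] at h1
  rw [← h1, Finset.card_filter, Finset.card_filter, Finset.sum_Ico_eq_sum_range]
  simp

/-- The elements `k` of `I` for which `k + s` is outside the first `g` residues modulo `H`. -/
def keptIndices (I : Finset ℕ) (H g s : ℕ) : Finset ℕ := I.filter fun k => g ≤ (k + s) % H

lemma sum_cosSum_keptIndices (a : ℕ → ℕ) (c : ℕ → ℝ) (I : Finset ℕ) (H g : ℕ) (x : ℝ) :
    ∑ s ∈ Finset.range H, cosSum a c (keptIndices I H g s) x =
      ((H - g : ℕ) : ℝ) * cosSum a c I x := by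
  simp only [cosSum, keptIndices, Finset.sum_filter]
  rw [Finset.sum_comm, Finset.mul_sum]
  refine Finset.sum_congr rfl fun k _ => ?_
  rw [← Finset.sum_filter, Finset.sum_const, card_filter_le_add_mod, nsmul_eq_mul]

theorem Lacunary.integral_exp_cosSum_keptIndices_le {q : ℝ} {a : ℕ → ℕ} (ha : Lacunary q a)
    {g : ℕ} (hg : 4 < q ^ g * (1 - 1 / q)) (c : ℕ → ℝ) (I : Finset ℕ) {H : ℕ} (hH0 : 0 < H)
    (s : ℕ) {b : ℝ} (hb : 0 ≤ b) (hc : ∀ k ∈ I, |c k| ≤ b) (hHb : H * b ≤ 1) :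
    ∫ x, exp (cosSum a c (keptIndices I H g s) x) ∂unitMeasure ≤
      exp ((1 / 4 + H ^ 2 * b) * ∑ k ∈ I, c k ^ 2) := by
  set K := keptIndices I H g s with hK
  set B : ℕ → Finset ℕ := fun j => K.filter fun k => (k + s) / H = j with hBdef
  set J := K.image fun k => (k + s) / H
  have hfib : ∀ f : ℕ → ℝ, ∑ j ∈ J, ∑ k ∈ B j, f k = ∑ k ∈ K, f k := fun f =>
    Finset.sum_fiberwise_of_maps_to (fun k hk => Finset.mem_image_of_mem _ hk) f
  have hsep : ∀ i j, i < j → ∀ k ∈ B i, ∀ l ∈ B j, k + g ≤ l := by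
    intro i j hij k hk l hl
    simp only [hBdef, hK, keptIndices, Finset.mem_filter] at hk hl
    have h1 := Nat.div_add_mod (k + s) H
    have h2 := Nat.div_add_mod (l + s) H
    have h3 := Nat.mod_lt (k + s) hH0
    rw [hk.2] at h1
    rw [hl.2] at h2
    have h4 : H * (i + 1) ≤ H * j := Nat.mul_le_mul_left _ hij
    have h5 := hl.1.2
    rw [mul_add] at h4
    omega
  have hcard : ∀ i ∈ J, (B i).card ≤ H := by
    intro i _
    calc (B i).card ≤ (Finset.range H).card := by
          refine Finset.card_le_card_of_injOn (fun k => (k + s) % H)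
            (fun k _ => by simpa using Nat.mod_lt _ hH0) ?_
          intro k hk l hl hkl
          simp only [hBdef, Finset.coe_filter, Set.mem_ofPred_eq] at hk hl hkl
          have h1 := Nat.div_add_mod (k + s) H
          have h2 := Nat.div_add_mod (l + s) H
          rw [hk.2] at h1
          rw [hl.2] at h2
          omega
      _ = H := Finset.card_range H
  have h := ha.integral_exp_sum_blocks_le hg c B hsep J hb hcard
    (fun i _ k hk => hc k (Finset.filter_subset _ _ (Finset.filter_subset _ _ hk))) hHb
  simp only [cosSum, hfib] at h
  refine h.trans (exp_le_exp.2 ?_)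
  gcongr
  exact Finset.filter_subset _ _

lemma Lacunary.exists_gap {q : ℝ} {a : ℕ → ℕ} (ha : Lacunary q a) :
    ∃ g : ℕ, 0 < g ∧ 4 < q ^ g * (1 - 1 / q) := by
  have hq := ha.one_lt
  have h0 : 0 < 1 - 1 / q := by
    rw [sub_pos, div_lt_one (by linarith)]; exact hq
  have := ((tendsto_pow_atTop_atTop_of_one_lt hq).atTop_mul_const h0).eventually_gt_atTop 4
  exact ((eventually_gt_atTop 0).and this).exists

/-- Sub-Gaussian bound for the Laplace transform of a lacunary cosine polynomial with small
coefficients, with the sharp constant. -/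
theorem Lacunary.integral_exp_cosSum_le {q : ℝ} {a : ℕ → ℕ} (ha : Lacunary q a) {ε : ℝ}
    (hε : 0 < ε) : ∃ b > 0, ∀ (c : ℕ → ℝ) (I : Finset ℕ), (∀ k ∈ I, |c k| ≤ b) →
      ∫ x, exp (cosSum a c I x) ∂unitMeasure ≤ exp ((1 + ε) / 4 * ∑ k ∈ I, c k ^ 2) := by
  obtain ⟨g, hg0, hg⟩ := ha.exists_gap
  obtain ⟨t, ht⟩ := exists_nat_gt (6 / ε + 1)
  have h6 : 0 < 6 / ε := by positivity
  have ht1 : (1 : ℝ) < t := by linarith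
  have ht0 : 0 < t := by exact_mod_cast (by linarith : (0 : ℝ) < t)
  set H := g * (t + 1) with hH
  have hH0 : 0 < H := by positivity
  set ρ : ℝ := (t + 1) / t with hρ
  have hρ2 : ρ ≤ 2 := by rw [hρ, div_le_iff₀ (by linarith)]; linarith
  have hρ1 : 0 < ρ := by positivity
  have hρsq : ρ ^ 2 ≤ 1 + ε / 2 := by
    have h1 : 1 / (t : ℝ) ≤ ε / 6 := by
      rw [div_le_div_iff₀ (by linarith) (by norm_num)]
      have : 6 / ε * ε = 6 := by field_simp
      nlinarith
    have h2 : ρ = 1 + 1 / t := by rw [hρ]; field_simp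
    have h3 : 1 / (t : ℝ) ≤ 1 := by rw [div_le_one (by linarith)]; exact ht1.le
    have h4 : 0 < 1 / (t : ℝ) := by positivity
    rw [h2]; nlinarith
  have hHR : (1 : ℝ) ≤ H := by exact_mod_cast hH0
  have hbpos : 0 < ε / ((2 + ε) * (8 * (H : ℝ) ^ 2)) := by positivity
  refine ⟨ε / ((2 + ε) * (8 * (H : ℝ) ^ 2)), hbpos, fun c I hc => ?_⟩
  set b := ε / ((2 + ε) * (8 * (H : ℝ) ^ 2)) with hbdef
  have hb : 8 * (H : ℝ) ^ 2 * b = ε / (2 + ε) := by rw [hbdef]; field_simp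
  have hlt : ε / (2 + ε) ≤ 1 := by rw [div_le_one (by linarith)]; linarith
  have hbig : (H : ℝ) * (2 * b) ≤ 1 := by nlinarith [mul_pos (by linarith : (0 : ℝ) < H) hbpos]
  have hscale : ∀ s x, ρ * cosSum a c (keptIndices I H g s) x =
      cosSum a (fun k => ρ * c k) (keptIndices I H g s) x := fun s x => by
    simp only [cosSum, Finset.mul_sum, mul_assoc]
  have hpt : ∀ x, exp (cosSum a c I x) ≤ ∑ s ∈ Finset.range H, (1 / H : ℝ) *
      exp (cosSum a (fun k => ρ * c k) (keptIndices I H g s) x) := fun x => by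
    have h1 : cosSum a c I x = ∑ s ∈ Finset.range H, (1 / H : ℝ) •
        cosSum a (fun k => ρ * c k) (keptIndices I H g s) x := by
      simp only [← hscale, smul_eq_mul, ← Finset.mul_sum]
      rw [sum_cosSum_keptIndices, hρ, show H - g = g * t by rw [hH, mul_add]; omega, hH]
      push_cast
      field_simp
    rw [h1]
    exact convexOn_exp.map_sum_le (fun _ _ => by positivity) (by simp; field_simp)
      (fun _ _ => Set.mem_univ _)
  have hInt : ∀ s, Integrable (fun x => exp (cosSum a (fun k => ρ * c k)
      (keptIndices I H g s) x)) unitMeasure := fun s =>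
    Continuous.integrable_unitMeasure (continuous_exp.comp (continuous_cosSum _ _ _))
  calc ∫ x, exp (cosSum a c I x) ∂unitMeasure
      ≤ ∫ x, ∑ s ∈ Finset.range H, (1 / H : ℝ) *
      exp (cosSum a (fun k => ρ * c k) (keptIndices I H g s) x) ∂unitMeasure :=
        integral_mono (Continuous.integrable_unitMeasure
          (continuous_exp.comp (continuous_cosSum _ _ _)))
          (integrable_finsetSum _ fun s _ => (hInt s).const_mul _) hpt
    _ = ∑ s ∈ Finset.range H, (1 / H : ℝ) *
      ∫ x, exp (cosSum a (fun k => ρ * c k) (keptIndices I H g s) x) ∂unitMeasure := by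
        rw [integral_finsetSum _ fun s _ => (hInt s).const_mul _]
        simp only [integral_const_mul]
    _ ≤ ∑ s ∈ Finset.range H, (1 / H : ℝ) * exp ((1 + ε) / 4 * ∑ k ∈ I, c k ^ 2) := by
        gcongr with s _
        refine (ha.integral_exp_cosSum_keptIndices_le hg _ I hH0 s (b := 2 * b)
          (by positivity) (fun k hk => ?_) hbig).trans (exp_le_exp.2 ?_)
        · rw [abs_mul, abs_of_pos hρ1]
          exact mul_le_mul hρ2 (hc k hk) (abs_nonneg _) (by norm_num)
        · simp only [mul_pow, ← Finset.mul_sum]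
          rw [← mul_assoc]
          refine mul_le_mul_of_nonneg_right ?_ (Finset.sum_nonneg fun _ _ => sq_nonneg _)
          have h1 : 1 / 4 + (H : ℝ) ^ 2 * (2 * b) = (1 + ε / (2 + ε)) / 4 := by
            rw [← hb]; ring
          have h2 : (1 + ε / (2 + ε)) * (1 + ε / 2) = 1 + ε := by field_simp; ring
          rw [h1]
          calc (1 + ε / (2 + ε)) / 4 * ρ ^ 2 ≤ (1 + ε / (2 + ε)) / 4 * (1 + ε / 2) := by gcongr
            _ = (1 + ε) / 4 := by rw [← h2]; ring
    _ = exp ((1 + ε) / 4 * ∑ k ∈ I, c k ^ 2) := by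
        rw [Finset.sum_const, Finset.card_range, nsmul_eq_mul, ← mul_assoc]
        field_simp

lemma ae_eventually_notMem_of_summable {Ω : Type*} [MeasurableSpace Ω] {μ : Measure Ω}
    [IsFiniteMeasure μ] {E : ℕ → Set Ω} {u : ℕ → ℝ} (hu : Summable u)
    (h : ∀ᶠ r in atTop, μ.real (E r) ≤ u r) : ∀ᵐ x ∂μ, ∀ᶠ r in atTop, x ∉ E r := by
  have hs : Summable fun r => μ.real (E r) :=
    Summable.of_norm_bounded_eventually_nat hu
      (h.mono fun r hr => by rwa [Real.norm_of_nonneg measureReal_nonneg])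
  refine ae_eventually_notMem ?_
  have : ∀ r, μ (E r) = ENNReal.ofReal (μ.real (E r)) := fun r => by simp
  simp only [this]
  exact hs.tsum_ofReal_ne_top

/-- The Laplace transforms of the cosine polynomials with frequencies in `a` and coefficients at
most `b` are sub-Gaussian with variance proxy `(1 + ε) / 2` times the sum of squared
coefficients. -/
def SubGaussianBelow (a : ℕ → ℕ) (ε b : ℝ) : Prop :=
  ∀ (c : ℕ → ℝ) (I : Finset ℕ), (∀ k ∈ I, |c k| ≤ b) →
    ∫ x, exp (cosSum a c I x) ∂unitMeasure ≤ exp ((1 + ε) / 4 * ∑ k ∈ I, c k ^ 2)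

namespace SubGaussianBelow

variable {a : ℕ → ℕ} {ε b : ℝ}

lemma integral_exp_const_mul_le (h : SubGaussianBelow a ε b) {y : ℝ} (hy : |y| ≤ b)
    (I : Finset ℕ) : ∫ x, exp (y * cosSum a 1 I x) ∂unitMeasure ≤
      exp ((1 + ε) / 4 * (y ^ 2 * I.card)) := by
  have := h (fun _ => y) I fun _ _ => hy
  simp only [Finset.sum_const, nsmul_eq_mul] at this
  rw [mul_comm (I.card : ℝ)] at this
  refine le_trans (le_of_eq ?_) this
  simp [cosSum, Finset.mul_sum]

lemma measure_abs_ge_le (h : SubGaussianBelow a ε b) {y : ℝ} (hy0 : 0 ≤ y) (hy : y ≤ b)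
    (I : Finset ℕ) (t : ℝ) : unitMeasure.real {x | t ≤ |cosSum a 1 I x|} ≤
      2 * exp (-(y * t) + (1 + ε) / 4 * (y ^ 2 * I.card)) := by
  have hInt : ∀ z : ℝ, Integrable (fun x => exp (z * cosSum a 1 I x)) unitMeasure := fun z =>
    Continuous.integrable_unitMeasure (continuous_exp.comp ((continuous_cosSum _ _ _).const_mul _))
  have hsub : {x | t ≤ |cosSum a 1 I x|} ⊆
      {x | t ≤ cosSum a 1 I x} ∪ {x | cosSum a 1 I x ≤ -t} := fun x hx => by
    rcases le_abs.1 (show t ≤ |cosSum a 1 I x| from hx) with h | h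
    · exact Or.inl h
    · exact Or.inr (show cosSum a 1 I x ≤ -t by linarith)
  have h1 := ProbabilityTheory.measure_ge_le_exp_mul_mgf t hy0 (hInt y)
  have h2 := ProbabilityTheory.measure_le_le_exp_mul_mgf (-t) (neg_nonpos.2 hy0) (hInt (-y))
  have h3 := h.integral_exp_const_mul_le (y := y) (by rwa [abs_of_nonneg hy0]) I
  have h4 := h.integral_exp_const_mul_le (y := -y) (by rwa [abs_neg, abs_of_nonneg hy0]) I
  rw [neg_sq] at h4
  have e1 : -y * t = -(y * t) := by ring
  have e2 : - -y * -t = -(y * t) := by ring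
  rw [e1] at h1
  rw [e2] at h2
  refine (measureReal_mono hsub).trans ((measureReal_union_le _ _).trans ?_)
  rw [exp_add, two_mul]
  refine add_le_add (h1.trans ?_) (h2.trans ?_)
  · exact mul_le_mul_of_nonneg_left h3 (exp_pos _).le
  · exact mul_le_mul_of_nonneg_left h4 (exp_pos _).le

lemma ae_eventually_abs_lt (h : SubGaussianBelow a ε b) (hε : 0 ≤ 1 + ε) {ι : Type*}
    (F : ℕ → Finset ι) (I : ℕ → ι → Finset ℕ) (t y V u : ℕ → ℝ) (hu : Summable u)
    (hy0 : ∀ r, 0 ≤ y r) (hyb : ∀ᶠ r in atTop, y r ≤ b)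
    (hV : ∀ᶠ r in atTop, ∀ i ∈ F r, ((I r i).card : ℝ) ≤ V r)
    (hb : ∀ᶠ r in atTop,
      (F r).card * (2 * exp (-(y r * t r) + (1 + ε) / 4 * (y r ^ 2 * V r))) ≤ u r) :
    ∀ᵐ x ∂unitMeasure, ∀ᶠ r in atTop, ∀ i ∈ F r, |cosSum a 1 (I r i) x| < t r := by
  have := ae_eventually_notMem_of_summable (μ := unitMeasure)
    (E := fun r => ⋃ i ∈ F r, {x | t r ≤ |cosSum a 1 (I r i) x|}) hu (by
      filter_upwards [hyb, hV, hb] with r h1 h2 h3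
      refine (measureReal_biUnion_finset_le _ _).trans (le_trans ?_ h3)
      rw [← nsmul_eq_mul]
      refine Finset.sum_le_card_nsmul _ _ _ fun i hi => ?_
      refine (h.measure_abs_ge_le (hy0 r) h1 (I r i) (t r)).trans ?_
      have := h2 i hi
      gcongr)
  filter_upwards [this] with x hx
  filter_upwards [hx] with r hr i hi
  by_contra hlt
  exact hr (Set.mem_biUnion hi (not_lt.1 hlt))

end SubGaussianBelow

lemma eventually_sq_mul_sqrt_log_div_le {b : ℝ} (hb : 0 < b) :
    ∀ᶠ r : ℕ in atTop, (r : ℝ) ^ 2 * √(log r / 2 ^ r) ≤ b := by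
  have h := (tendsto_pow_const_div_const_pow_of_one_lt 5 (r := (2 : ℝ))
    one_lt_two).eventually_le_const
    (by positivity : 0 < b ^ 2)
  filter_upwards [h] with r hr
  have h2 : ((r : ℝ) ^ 2) ^ 2 * (log r / 2 ^ r) ≤ b ^ 2 := by
    refine le_trans ?_ hr
    rw [← mul_div_assoc]
    gcongr
    calc ((r : ℝ) ^ 2) ^ 2 * log r ≤ ((r : ℝ) ^ 2) ^ 2 * r := by
          gcongr; exact log_le_self (by positivity)
      _ = (r : ℝ) ^ 5 := by ring
  calc (r : ℝ) ^ 2 * √(log r / 2 ^ r) = √(((r : ℝ) ^ 2) ^ 2 * (log r / 2 ^ r)) := by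
        rw [Real.sqrt_mul (by positivity), Real.sqrt_sq (by positivity)]
    _ ≤ √(b ^ 2) := Real.sqrt_le_sqrt h2
    _ = b := Real.sqrt_sq hb.le

lemma eventually_two_mul_sqrt_log_div_le {b : ℝ} (hb : 0 < b) :
    ∀ᶠ r : ℕ in atTop, 2 * √(log r / 2 ^ r) ≤ b := by
  filter_upwards [eventually_sq_mul_sqrt_log_div_le hb, eventually_ge_atTop 2] with r h1 h2
  have : (2 : ℝ) ≤ r := by exact_mod_cast h2
  refine le_trans ?_ h1
  gcongr
  nlinarith

lemma exp_neg_mul_log {r : ℕ} (hr : 0 < r) (s : ℝ) : exp (-(s * log r)) = 1 / (r : ℝ) ^ s := by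
  have : (0 : ℝ) < r := by exact_mod_cast hr
  rw [rpow_def_of_pos this, one_div, ← exp_neg, mul_comm]

theorem Lacunary.ae_eventually_abs_dyadic_lt {q : ℝ} {a : ℕ → ℕ} (ha : Lacunary q a) {ε : ℝ}
    (hε : 0 < ε) {j : ℕ} (hj : 0 < j) : ∀ᵐ x ∂unitMeasure, ∀ᶠ r : ℕ in atTop,
      |cosSum a 1 (Finset.range (j * 2 ^ r)) x| < (1 + ε) * √(j * 2 ^ r * log r) := by
  obtain ⟨b, hb, h⟩ := ha.integral_exp_cosSum_le hε
  have hj' : (1 : ℝ) ≤ j := by exact_mod_cast hj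
  have := SubGaussianBelow.ae_eventually_abs_lt (a := a) h (by linarith) (fun _ => Finset.range 1)
    (fun r _ => Finset.range (j * 2 ^ r)) (fun r => (1 + ε) * √(j * 2 ^ r * log r))
    (fun r => 2 * √(log r / (j * 2 ^ r))) (fun r => j * 2 ^ r)
    (fun r => 2 * (1 / (r : ℝ) ^ (1 + ε)))
    ((Real.summable_one_div_nat_rpow.2 (by linarith)).mul_left 2) (fun r => by positivity) ?_ ?_ ?_
  · simpa using this
  · filter_upwards [eventually_two_mul_sqrt_log_div_le hb] with r hr
    refine le_trans ?_ hr
    gcongr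
    exact le_mul_of_one_le_left (by positivity) hj'
  · exact Eventually.of_forall fun r i _ => by simp
  · filter_upwards [eventually_ge_atTop 3] with r hr
    have hℓ : 0 ≤ log r := log_natCast_nonneg r
    rw [Finset.card_range, Nat.cast_one, one_mul, ← exp_neg_mul_log (by omega)]
    refine le_of_eq ?_
    congr 2
    have e1 : √(log r / (j * 2 ^ r)) * √(j * 2 ^ r * log r) = log r := by
      rw [← Real.sqrt_mul (by positivity)]
      rw [show log r / (j * 2 ^ r) * (j * 2 ^ r * log r) = log r ^ 2 by field_simp]
      exact Real.sqrt_sq hℓ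
    have e2 : √(log r / (j * 2 ^ r)) ^ 2 * (j * 2 ^ r) = log r := by
      rw [Real.sq_sqrt (by positivity)]; field_simp
    linear_combination (-2 * (1 + ε)) * e1 + (1 + ε) * e2

/-- Uniform control of the oscillation of the partial sums over a dyadic range. -/
theorem Lacunary.ae_eventually_abs_increment_lt {q : ℝ} {a : ℕ → ℕ} (ha : Lacunary q a) (j : ℕ) :
    ∀ᵐ x ∂unitMeasure, ∀ᶠ r : ℕ in atTop, ∀ n < 2 ^ r,
      |cosSum a 1 (Finset.Ico (j * 2 ^ r) (j * 2 ^ r + n)) x| < 8 * √(2 ^ r * log r) := by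
  obtain ⟨b, hb, h⟩ := ha.integral_exp_cosSum_le one_pos
  set L : ℕ → ℕ := fun r => 2 ^ r / r ^ 2 + 1 with hL
  have hrr : ∀ᶠ r : ℕ in atTop, r ^ 2 ≤ 2 ^ r := by
    have h := (tendsto_pow_const_div_const_pow_of_one_lt 2 (r := (2 : ℝ))
      one_lt_two).eventually_le_const one_pos
    filter_upwards [h] with r hr
    rw [div_le_one (by positivity)] at hr
    exact_mod_cast hr
  have hsq : ∀ r : ℕ, √(log r / 2 ^ r) * √(2 ^ r * log r) = log r := fun r => by
    rw [← Real.sqrt_mul (div_nonneg (log_natCast_nonneg r) (by positivity)),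
      show log r / 2 ^ r * (2 ^ r * log r) = log r ^ 2 by field_simp]
    exact Real.sqrt_sq (log_natCast_nonneg r)
  have hsq2 : ∀ r : ℕ, √(log r / 2 ^ r) ^ 2 * 2 ^ r = log r := fun r => by
    rw [Real.sq_sqrt (div_nonneg (log_natCast_nonneg r) (by positivity))]; field_simp
  have hcoarse := SubGaussianBelow.ae_eventually_abs_lt (a := a) h (by norm_num)
    (fun r => Finset.range (r ^ 2 + 1))
    (fun r i => Finset.Ico (j * 2 ^ r) (j * 2 ^ r + i * L r)) (fun r => 4 * √(2 ^ r * log r))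
    (fun r => 2 * √(log r / 2 ^ r)) (fun r => 2 * 2 ^ r) (fun r => 4 * (1 / (r : ℝ) ^ (2 : ℝ)))
    ((Real.summable_one_div_nat_rpow.2 (by norm_num)).mul_left 4) (fun r => by positivity)
    (eventually_two_mul_sqrt_log_div_le hb) ?_ ?_
  · have hfine := SubGaussianBelow.ae_eventually_abs_lt (a := a) h (by norm_num)
      (fun r => Finset.range (r ^ 2 + 1) ×ˢ Finset.range (L r))
      (fun r i => Finset.Ico (j * 2 ^ r + i.1 * L r) (j * 2 ^ r + i.1 * L r + i.2))
      (fun r => 4 * √(2 ^ r * log r))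
      (fun r => (r : ℝ) ^ 2 * √(log r / 2 ^ r)) (fun r => L r) (fun r => 8 * (1 / 2 : ℝ) ^ r)
      (summable_geometric_two.mul_left 8) (fun r => by positivity)
      (eventually_sq_mul_sqrt_log_div_le hb) ?_ ?_
    · filter_upwards [hcoarse, hfine] with x h1 h2
      filter_upwards [h1, h2, eventually_gt_atTop 0] with r h1 h2 hr n hn
      have hLpos : 0 < L r := by simp [hL]
      have hi : n / L r < r ^ 2 + 1 := by
        refine Nat.lt_succ_of_le (Nat.div_le_of_le_mul ?_)
        have h3 := Nat.lt_mul_div_succ (2 ^ r) (pow_pos hr 2)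
        calc n ≤ r ^ 2 * (2 ^ r / r ^ 2 + 1) := by omega
          _ = L r * r ^ 2 := by simp only [hL]; ring
      have hmod := Nat.mod_lt n hLpos
      have hdm : n / L r * L r + n % L r = n := by rw [mul_comm]; exact Nat.div_add_mod n (L r)
      have h3 := h1 (n / L r) (by simpa using hi)
      have h4 := h2 (n / L r, n % L r) (by simp [hi, hmod])
      simp only [add_assoc, hdm] at h4
      have hsplit : cosSum a 1 (Finset.Ico (j * 2 ^ r) (j * 2 ^ r + n)) x =
          cosSum a 1 (Finset.Ico (j * 2 ^ r) (j * 2 ^ r + n / L r * L r)) x +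
          cosSum a 1 (Finset.Ico (j * 2 ^ r + n / L r * L r) (j * 2 ^ r + n)) x :=
        (Finset.sum_Ico_consecutive _ (by omega) (by omega)).symm
      rw [hsplit]
      refine (abs_add_le _ _).trans_lt ?_
      linarith
    · refine Eventually.of_forall fun r i hi => ?_
      simp only [Finset.mem_product, Finset.mem_range] at hi
      simp only [Nat.card_Ico, add_tsub_cancel_left]
      exact_mod_cast hi.2.le
    · filter_upwards [hrr, eventually_ge_atTop 3] with r h1 h2
      have hr3 : (3 : ℝ) ≤ r := by exact_mod_cast h2
      have hℓ : 1 ≤ log r := by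
        rw [le_log_iff_exp_le (by linarith)]
        linarith [exp_one_lt_d9]
      have hrr' : (r : ℝ) ^ 2 ≤ 2 ^ r := by exact_mod_cast h1
      have hLr : (r : ℝ) ^ 2 * L r ≤ 2 * 2 ^ r := by
        have : r ^ 2 * (2 ^ r / r ^ 2) ≤ 2 ^ r := Nat.mul_div_le _ _
        have h3 : r ^ 2 * L r ≤ 2 * 2 ^ r := by simp only [hL]; rw [mul_add]; omega
        exact_mod_cast h3
      have hexp : -((r : ℝ) ^ 2 * √(log r / 2 ^ r) * (4 * √(2 ^ r * log r))) +
          (1 + 1) / 4 * (((r : ℝ) ^ 2 * √(log r / 2 ^ r)) ^ 2 * (L r : ℝ)) ≤ -(3 * r) := by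
        have e1 : (r : ℝ) ^ 2 * √(log r / 2 ^ r) * (4 * √(2 ^ r * log r)) =
            4 * r ^ 2 * log r := by
          linear_combination (4 * (r : ℝ) ^ 2) * hsq r
        have e2 : (((r : ℝ) ^ 2 * √(log r / 2 ^ r)) ^ 2 * (L r : ℝ)) ≤ 2 * (r ^ 2 * log r) := by
          calc (((r : ℝ) ^ 2 * √(log r / 2 ^ r)) ^ 2 * (L r : ℝ)) =
              r ^ 2 * √(log r / 2 ^ r) ^ 2 * (r ^ 2 * L r) := by ring
            _ ≤ r ^ 2 * √(log r / 2 ^ r) ^ 2 * (2 * 2 ^ r) := by gcongr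
            _ = _ := by linear_combination (2 * (r : ℝ) ^ 2) * hsq2 r
        have e3 : (r : ℝ) ≤ r ^ 2 * log r := by nlinarith
        linarith
      have hcard : (((Finset.range (r ^ 2 + 1) ×ˢ Finset.range (L r)).card : ℕ) : ℝ) ≤
          4 * 2 ^ r := by
        rw [Finset.card_product, Finset.card_range, Finset.card_range]
        push_cast
        have : (1 : ℝ) ≤ r ^ 2 := by nlinarith
        nlinarith [(Nat.cast_nonneg (L r) : (0 : ℝ) ≤ L r)]
      calc _ ≤ 4 * 2 ^ r * (2 * exp (-(3 * r))) := by gcongr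
        _ = 8 * (2 * exp (-3)) ^ r := by
          rw [mul_pow, ← exp_nat_mul]; ring_nf
        _ ≤ 8 * (1 / 2) ^ r := by
          gcongr
          have h4 : (4 : ℝ) ≤ exp 3 := by linarith [add_one_le_exp (3 : ℝ)]
          have h5 : exp (-3) ≤ 1 / 4 := by
            rw [exp_neg, one_div]; exact inv_anti₀ (by norm_num) h4
          linarith
  · filter_upwards [hrr] with r h1 i hi
    simp only [Finset.mem_range] at hi
    simp only [Nat.card_Ico, add_tsub_cancel_left]
    have h2 : i * L r ≤ 2 * 2 ^ r := by
      calc i * L r ≤ r ^ 2 * (2 ^ r / r ^ 2 + 1) := Nat.mul_le_mul_right _ (by omega)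
        _ = r ^ 2 * (2 ^ r / r ^ 2) + r ^ 2 := by ring
        _ ≤ 2 * 2 ^ r := by have := Nat.mul_div_le (2 ^ r) (r ^ 2); omega
    exact_mod_cast h2
  · filter_upwards [eventually_ge_atTop 3] with r hr
    have hr3 : (3 : ℝ) ≤ r := by exact_mod_cast hr
    have hexp : -(2 * √(log r / 2 ^ r) * (4 * √(2 ^ r * log r))) +
        (1 + 1) / 4 * ((2 * √(log r / 2 ^ r)) ^ 2 * (2 * 2 ^ r)) = -((4 : ℝ) * log r) := by
      linear_combination (-8) * hsq r + 4 * hsq2 r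
    rw [hexp, exp_neg_mul_log (by omega), Finset.card_range]
    push_cast
    rw [show (4 : ℝ) = ((4 : ℕ) : ℝ) by norm_num, show (2 : ℝ) = ((2 : ℕ) : ℝ) by norm_num]
    simp only [rpow_natCast]
    push_cast
    rw [mul_one_div, mul_one_div, mul_div_assoc', div_le_div_iff₀ (by positivity) (by positivity)]
    have : (1 : ℝ) ≤ r ^ 2 := by nlinarith
    nlinarith [sq_nonneg ((r : ℝ) ^ 2)]

/-- Upper half of the law of the iterated logarithm. -/
theorem Lacunary.ae_eventually_abs_le {q : ℝ} {a : ℕ → ℕ} (ha : Lacunary q a) {ε : ℝ}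
    (hε : 0 < ε) : ∀ᵐ x ∂unitMeasure, ∀ᶠ N : ℕ in atTop,
      |cosSum a 1 (Finset.range N) x| ≤ (1 + ε) * √(N * log (log N)) := by
  set δ := min ε 1 / 5 with hδ
  have hδ0 : 0 < δ := by positivity
  have hδε : 5 * δ ≤ ε := by rw [hδ]; linarith [min_le_left ε 1]
  have hδ1 : 5 * δ ≤ 1 := by rw [hδ]; linarith [min_le_right ε 1]
  obtain ⟨p, hp⟩ := pow_unbounded_of_one_lt ((8 / δ) ^ 2) one_lt_two
  have hp8 : 8 ≤ δ * √(2 ^ p) := by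
    have h1 : 8 / δ ≤ √(2 ^ p) := Real.le_sqrt_of_sq_le hp.le
    rwa [div_le_iff₀' hδ0] at h1
  have h1 : ∀ᵐ x ∂unitMeasure, ∀ j ∈ Finset.Ico (2 ^ p) (2 ^ (p + 1)), ∀ᶠ r : ℕ in atTop,
      |cosSum a 1 (Finset.range (j * 2 ^ r)) x| < (1 + δ) * √(j * 2 ^ r * log r) ∧
      ∀ n < 2 ^ r,
        |cosSum a 1 (Finset.Ico (j * 2 ^ r) (j * 2 ^ r + n)) x| < 8 * √(2 ^ r * log r) := by
    rw [Filter.eventually_all_finset]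
    intro j hj
    have hj0 : 0 < j := lt_of_lt_of_le (by positivity) (Finset.mem_Ico.1 hj).1
    filter_upwards [ha.ae_eventually_abs_dyadic_lt hδ0 hj0, ha.ae_eventually_abs_increment_lt j]
      with x hx1 hx2 using hx1.and hx2
  have hr : Tendsto (fun N : ℕ => Nat.log 2 N - p) atTop atTop :=
    (tendsto_sub_atTop_nat p).comp <| tendsto_atTop.2 fun m =>
      (eventually_ge_atTop (2 ^ m)).mono fun N hN =>
        (Nat.le_log_iff_pow_le one_lt_two (by have := Nat.one_le_two_pow (n := m); omega)).2 hN
  filter_upwards [h1] with x hx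
  rw [← Filter.eventually_all_finset] at hx
  have hlog : ∀ᶠ r : ℕ in atTop, (1 + δ) / δ ≤ log r :=
    (tendsto_log_atTop.comp tendsto_natCast_atTop_atTop).eventually_ge_atTop _
  filter_upwards [hr.eventually hx, hr.eventually hlog, hr.eventually (eventually_gt_atTop 0),
    eventually_ge_atTop 1] with N hN hℓ hr0 hN1
  set r := Nat.log 2 N - p with hrdef
  have hlogN : Nat.log 2 N = p + r := by omega
  have hlow : 2 ^ (p + r) ≤ N := hlogN ▸ Nat.pow_log_le_self 2 (by omega)
  have hupp : N < 2 ^ (p + r + 1) := hlogN ▸ Nat.lt_pow_succ_log_self one_lt_two N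
  have hj : N / 2 ^ r ∈ Finset.Ico (2 ^ p) (2 ^ (p + 1)) := by
    rw [Finset.mem_Ico, Nat.le_div_iff_mul_le (by positivity),
      Nat.div_lt_iff_lt_mul (by positivity),
      ← pow_add, ← pow_add]
    exact ⟨hlow, by rwa [show p + 1 + r = p + r + 1 by ring]⟩
  obtain ⟨h2, h3⟩ := hN _ hj
  have h3 := h3 (N % 2 ^ r) (Nat.mod_lt _ (by positivity))
  have hdm : N / 2 ^ r * 2 ^ r + N % 2 ^ r = N := by rw [mul_comm]; exact Nat.div_add_mod _ _
  set j := N / 2 ^ r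
  have hsplit : cosSum a 1 (Finset.range N) x = cosSum a 1 (Finset.range (j * 2 ^ r)) x +
      cosSum a 1 (Finset.Ico (j * 2 ^ r) N) x :=
    (Finset.sum_range_add_sum_Ico _ (by omega)).symm
  rw [hdm] at h3
  have hℓ0 : 0 ≤ log r := le_trans (by positivity) hℓ
  have hNr : ((2 : ℝ) ^ p) * 2 ^ r ≤ N := by rw [← pow_add]; exact_mod_cast hlow
  have hjN : (j : ℝ) * 2 ^ r ≤ N := by
    have : j * 2 ^ r ≤ N := by omega
    exact_mod_cast this
  have hb1 : √(j * 2 ^ r * log r) ≤ √(N * log r) := Real.sqrt_le_sqrt (by gcongr)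
  have hb2 : 8 * √(2 ^ r * log r) ≤ δ * √(N * log r) := by
    calc 8 * √(2 ^ r * log r) ≤ δ * √(2 ^ p) * √(2 ^ r * log r) := by gcongr
      _ = δ * √(2 ^ p * 2 ^ r * log r) := by
        rw [mul_assoc, ← Real.sqrt_mul (by positivity), mul_assoc (2 ^ p : ℝ)]
      _ ≤ _ := by gcongr
  have hr0' : (0 : ℝ) < r := by exact_mod_cast hr0
  have hll : log r - 1 ≤ log (log N) := by
    have h2N : (2 : ℝ) ^ r ≤ N := le_trans (le_mul_of_one_le_left (by positivity)
      (one_le_pow₀ one_le_two)) hNr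
    have h5 : r * log 2 ≤ log N := by
      rw [← log_pow]; exact log_le_log (by positivity) h2N
    have hl2 := log_two_gt_d9
    have h6 : log (r * log 2) ≤ log (log N) := log_le_log (by positivity) h5
    rw [log_mul (by positivity) (by positivity)] at h6
    have h7 := one_sub_inv_le_log_of_pos (show 0 < log 2 by positivity)
    have h8 : (log 2)⁻¹ ≤ 2 := by
      rw [inv_le_comm₀ (by positivity) (by norm_num)]; linarith
    linarith
  have hcmp : log r ≤ (1 + δ) * log (log N) := by
    rw [div_le_iff₀' hδ0] at hℓ
    nlinarith
  have hll0 : 0 ≤ log (log N) := by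
    by_contra hneg
    push Not at hneg
    nlinarith
  have hb3 : √(N * log r) ≤ (1 + δ) * √(N * log (log N)) := by
    refine Real.sqrt_le_iff.2 ⟨by positivity, ?_⟩
    rw [mul_pow, Real.sq_sqrt (by positivity)]
    calc N * log r ≤ N * ((1 + δ) * log (log N)) := by gcongr
      _ = (1 + δ) * (N * log (log N)) := by ring
      _ ≤ (1 + δ) ^ 2 * (N * log (log N)) := by gcongr; nlinarith
  rw [hsplit]
  calc _ ≤ |cosSum a 1 (Finset.range (j * 2 ^ r)) x| + |cosSum a 1 (Finset.Ico (j * 2 ^ r) N) x| :=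
        abs_add_le _ _
    _ ≤ (1 + 2 * δ) * √(N * log r) := by nlinarith
    _ ≤ (1 + 2 * δ) * ((1 + δ) * √(N * log (log N))) := by gcongr
    _ = ((1 + 2 * δ) * (1 + δ)) * √(N * log (log N)) := by ring
    _ ≤ (1 + ε) * √(N * log (log N)) := by gcongr; nlinarith

/-- A second moment criterion of Kochen–Stone type: nonnegative, pairwise at most uncorrelated
variables with means tending to `1` and slowly growing second moments do not vanish eventually. -/
theorem ae_frequently_ne_zero_of_second_moment {Ω : Type*} [MeasurableSpace Ω] {μ : Measure Ω}
    [IsProbabilityMeasure μ] {U : ℕ → Ω → ℝ} {d b : ℕ → ℝ} (hU : ∀ m, Measurable (U m))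
    (hInt : ∀ m, Integrable (U m) μ) (hInt2 : ∀ m l, Integrable (fun x => U m x * U l x) μ)
    (hd : Tendsto d atTop (nhds 0)) (hmean : ∀ m, 1 - d m ≤ ∫ x, U m x ∂μ)
    (hcross : ∀ m l, m ≠ l → ∫ x, U m x * U l x ∂μ ≤ 1) (hb0 : ∀ m, 0 ≤ b m)
    (hsq : ∀ m, ∫ x, U m x * U m x ∂μ ≤ b m)
    (hb : Tendsto (fun m : ℕ => b m / (m + 1)) atTop (nhds 0)) :
    ∀ᵐ x ∂μ, ∃ᶠ m in atTop, U m x ≠ 0 := by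
  set V : ℕ → Ω → ℝ := fun M x => (M : ℝ)⁻¹ * ∑ m ∈ Finset.range M, U m x with hV
  have hVint : ∀ M, Integrable (V M) μ := fun M =>
    (integrable_finsetSum _ fun m _ => hInt m).const_mul _
  have hV2 : ∀ M x, V M x * V M x =
      ((M : ℝ)⁻¹) ^ 2 * ∑ m ∈ Finset.range M, ∑ l ∈ Finset.range M, U m x * U l x := fun M x => by
    simp only [hV, ← Finset.sum_mul_sum]; ring
  have hVint2 : ∀ M, Integrable (fun x => V M x * V M x) μ := fun M => by
    simp only [hV2]
    exact (integrable_finsetSum _ fun m _ => integrable_finsetSum _ fun l _ =>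
      hInt2 m l).const_mul _
  have hexpand : ∀ M x, (V M x - 1) ^ 2 = V M x * V M x - 2 * V M x + 1 := fun M x => by ring
  have hInt3 : ∀ M, Integrable (fun x => (V M x - 1) ^ 2) μ := fun M => by
    simp only [hexpand]
    exact ((hVint2 M).sub ((hVint M).const_mul 2)).add (integrable_const 1)
  have hbound : ∀ᶠ M : ℕ in atTop, ∫ x, (V M x - 1) ^ 2 ∂μ ≤
      (M : ℝ)⁻¹ * ∑ m ∈ Finset.range M, b m / (m + 1) +
        2 * ((M : ℝ)⁻¹ * ∑ m ∈ Finset.range M, d m) := by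
    filter_upwards [eventually_gt_atTop 0] with M hM
    have hM' : (0 : ℝ) < M := by exact_mod_cast hM
    have e1 : ∫ x, V M x * V M x ∂μ ≤ 1 + (M : ℝ)⁻¹ * ∑ m ∈ Finset.range M, b m / (m + 1) := by
      simp only [hV2]
      rw [integral_const_mul, integral_finsetSum _ fun m _ =>
        integrable_finsetSum _ fun l _ => hInt2 m l]
      have : ∀ m ∈ Finset.range M, ∫ x, ∑ l ∈ Finset.range M, U m x * U l x ∂μ ≤
          M + M * (b m / (m + 1)) := fun m hm => by
        rw [integral_finsetSum _ fun l _ => hInt2 m l]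
        have hm1 : (m : ℝ) + 1 ≤ M := by exact_mod_cast Finset.mem_range.1 hm
        have hle : ∀ l ∈ Finset.range M, ∫ x, U m x * U l x ∂μ ≤ 1 + if m = l then b m else 0 :=
          fun l _ => by
            split_ifs with h
            · subst h; linarith [hsq m]
            · linarith [hcross m l h]
        refine (Finset.sum_le_sum hle).trans ?_
        rw [Finset.sum_add_distrib, Finset.sum_ite_eq, if_pos hm]
        simp only [Finset.sum_const, Finset.card_range, nsmul_eq_mul, mul_one]
        have : b m ≤ M * (b m / (m + 1)) := by
          rw [← mul_div_assoc, le_div_iff₀ (by positivity), mul_comm]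
          exact mul_le_mul_of_nonneg_right hm1 (hb0 m)
        linarith
      calc _ ≤ ((M : ℝ)⁻¹) ^ 2 * ∑ m ∈ Finset.range M, ((M : ℝ) + M * (b m / (m + 1))) := by
            gcongr with m hm; exact this m hm
        _ = _ := by
          rw [Finset.sum_add_distrib, ← Finset.mul_sum]
          simp only [Finset.sum_const, Finset.card_range, nsmul_eq_mul]
          field_simp
    have e2 : 1 - (M : ℝ)⁻¹ * ∑ m ∈ Finset.range M, d m ≤ ∫ x, V M x ∂μ := by
      simp only [hV]
      rw [integral_const_mul, integral_finsetSum _ fun m _ => hInt m]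
      calc _ = (M : ℝ)⁻¹ * ∑ m ∈ Finset.range M, (1 - d m) := by
            rw [Finset.sum_sub_distrib]
            simp only [Finset.sum_const, Finset.card_range, nsmul_eq_mul, mul_one]
            field_simp
        _ ≤ _ := by gcongr with m _; exact hmean m
    simp only [hexpand]
    rw [integral_add (f := fun x => V M x * V M x - 2 * V M x)
        ((hVint2 M).sub ((hVint M).const_mul 2)) (integrable_const 1),
      integral_sub (hVint2 M) ((hVint M).const_mul 2), integral_const_mul]
    simp only [integral_const, probReal_univ, smul_eq_mul, mul_one]
    linarith
  have hlim : Tendsto (fun M => ∫ x, (V M x - 1) ^ 2 ∂μ) atTop (nhds 0) := by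
    refine squeeze_zero' (Eventually.of_forall fun M => integral_nonneg fun x => sq_nonneg _)
      hbound ?_
    simpa using hb.cesaro.add (hd.cesaro.const_mul 2)
  have hVmeas : ∀ M, Measurable (V M) := fun M =>
    (Finset.measurable_fun_sum _ fun m _ => hU m).const_mul _
  have hmeas : ∀ M, Measurable fun x => ENNReal.ofReal ((V M x - 1) ^ 2) := fun M =>
    (((hVmeas M).sub_const 1).pow_const 2).ennreal_ofReal
  have hfatou : ∫⁻ x, liminf (fun M => ENNReal.ofReal ((V M x - 1) ^ 2)) atTop ∂μ = 0 := by
    refine le_antisymm ((lintegral_liminf_le hmeas).trans ?_) bot_le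
    have : Tendsto (fun M => ∫⁻ x, ENNReal.ofReal ((V M x - 1) ^ 2) ∂μ) atTop (nhds 0) := by
      simp only [← ofReal_integral_eq_lintegral_ofReal (hInt3 _)
        (Eventually.of_forall fun x => sq_nonneg _)]
      simpa using ENNReal.tendsto_ofReal hlim
    exact this.liminf_eq.le
  rw [lintegral_eq_zero_iff (Measurable.liminf hmeas)] at hfatou
  filter_upwards [hfatou] with x hx
  by_contra hcon
  rw [Filter.not_frequently] at hcon
  have h0 : Tendsto (fun m => U m x) atTop (nhds 0) :=
    tendsto_const_nhds.congr' (hcon.mono fun m hm => (not_not.1 hm).symm)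
  have h1 : Tendsto (fun M => ENNReal.ofReal ((V M x - 1) ^ 2)) atTop (nhds 1) := by
    have := ENNReal.tendsto_ofReal ((h0.cesaro.sub_const 1).pow 2)
    simpa using this
  rw [Pi.zero_apply, h1.liminf_eq] at hx
  exact one_ne_zero hx

/-- The `i`-th block of length `H`, with its first `g` elements removed. -/
def gapBlock (H g i : ℕ) : Finset ℕ := Finset.Ico (i * H + g) ((i + 1) * H)

lemma card_gapBlock (H g i : ℕ) : (gapBlock H g i).card = H - g := by
  rw [gapBlock, Nat.card_Ico, add_mul]; omega

lemma add_le_of_mem_gapBlock {H g i j k l : ℕ} (hij : i < j) (hk : k ∈ gapBlock H g i)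
    (hl : l ∈ gapBlock H g j) : k + g ≤ l := by
  rw [gapBlock, Finset.mem_Ico] at hk hl
  have : (i + 1) * H ≤ j * H := Nat.mul_le_mul_right _ hij
  omega

lemma pairwiseDisjoint_gapBlock (H g : ℕ) (s : Set ℕ) : s.PairwiseDisjoint (gapBlock H g) := by
  intro i _ j _ hij
  rw [Function.onFun, Finset.disjoint_left]
  intro k hk hk'
  rw [gapBlock, Finset.mem_Ico] at hk hk'
  rcases lt_or_gt_of_ne hij with h | h
  · have : (i + 1) * H ≤ j * H := Nat.mul_le_mul_right _ h
    omega
  · have : (j + 1) * H ≤ i * H := Nat.mul_le_mul_right _ h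
    omega

lemma div_eq_of_mem_gapBlock {H g i k : ℕ} (hk : k ∈ gapBlock H g i) : k / H = i := by
  rw [gapBlock, Finset.mem_Ico] at hk
  exact Nat.div_eq_of_lt_le (by omega) (by omega)

/-- The normalised Riesz type product over the blocks in `s`, with weight `y i` on block `i`. -/
noncomputable def rieszProd (a : ℕ → ℕ) (H g : ℕ) (y : ℕ → ℝ) (s : Finset ℕ) (x : ℝ) : ℝ :=
  ∏ i ∈ s, quadExp (y i * cosSum a 1 (gapBlock H g i) x) / (1 + y i ^ 2 * (H - g : ℕ) / 4)

lemma continuous_rieszProd (a : ℕ → ℕ) (H g : ℕ) (y : ℕ → ℝ) (s : Finset ℕ) :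
    Continuous (rieszProd a H g y s) :=
  continuous_finsetProd _ fun _ _ =>
    (continuous_quadExp.comp ((continuous_cosSum _ _ _).const_mul _)).div_const _

lemma rieszProd_pos (a : ℕ → ℕ) (H g : ℕ) (y : ℕ → ℝ) (s : Finset ℕ) (x : ℝ) :
    0 < rieszProd a H g y s x :=
  Finset.prod_pos fun _ _ => div_pos (quadExp_pos _) (by positivity)

namespace Lacunary

variable {q : ℝ} {a : ℕ → ℕ}

lemma integral_rieszProd (ha : Lacunary q a) {g : ℕ} (hg : 4 < q ^ g * (1 - 1 / q)) (H : ℕ)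
    (y : ℕ → ℝ) (s : Finset ℕ) : ∫ x, rieszProd a H g y s x ∂unitMeasure = 1 := by
  have h := ha.integral_prod_quadExp hg (fun k => y (k / H)) (gapBlock H g)
    (fun i j hij k hk l hl => add_le_of_mem_gapBlock hij hk hl) s
  have h1 : ∀ i x, cosSum a (fun k => y (k / H)) (gapBlock H g i) x =
      y i * cosSum a 1 (gapBlock H g i) x := fun i x => by
    simp only [cosSum, Finset.mul_sum]
    refine Finset.sum_congr rfl fun k hk => ?_
    rw [div_eq_of_mem_gapBlock hk, Pi.one_apply, one_mul]
  have h2 : ∀ i, (∑ k ∈ gapBlock H g i, y (k / H) ^ 2) = y i ^ 2 * (H - g : ℕ) := fun i => by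
    rw [Finset.sum_congr rfl fun k hk => by rw [div_eq_of_mem_gapBlock hk], Finset.sum_const,
      card_gapBlock, nsmul_eq_mul, mul_comm]
  simp only [h1, h2] at h
  simp only [rieszProd, Finset.prod_div_distrib]
  rw [integral_div, h]
  exact div_self (Finset.prod_pos fun i _ => by positivity).ne'

lemma integral_rieszProd_mul (ha : Lacunary q a) {g : ℕ} (hg : 4 < q ^ g * (1 - 1 / q)) (H : ℕ)
    (y z : ℝ) {s t : Finset ℕ} (hst : Disjoint s t) :
    ∫ x, rieszProd a H g (fun _ => y) s x * rieszProd a H g (fun _ => z) t x ∂unitMeasure = 1 := by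
  rw [← ha.integral_rieszProd hg H (fun i => if i ∈ s then y else z) (s ∪ t)]
  congr 1
  funext x
  rw [rieszProd, rieszProd, rieszProd, Finset.prod_union hst]
  congr 1
  · exact Finset.prod_congr rfl fun i hi => by rw [if_pos hi]
  · exact Finset.prod_congr rfl fun i hi => by rw [if_neg (Finset.disjoint_right.1 hst hi)]

end Lacunary

lemma cosSum_biUnion_gapBlock (a : ℕ → ℕ) (H g : ℕ) (s : Finset ℕ) (x : ℝ) :
    cosSum a 1 (s.biUnion (gapBlock H g)) x = ∑ i ∈ s, cosSum a 1 (gapBlock H g i) x :=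
  Finset.sum_biUnion (pairwiseDisjoint_gapBlock H g s)

lemma card_biUnion_gapBlock (H g : ℕ) (s : Finset ℕ) :
    (s.biUnion (gapBlock H g)).card = s.card * (H - g) := by
  rw [Finset.card_biUnion (pairwiseDisjoint_gapBlock H g s)]
  simp [card_gapBlock]

lemma rieszProd_le_exp (a : ℕ → ℕ) {H g : ℕ} (hH : 0 < H) {y η : ℝ} (hy : 0 ≤ y) (hη : η ≤ 1)
    (hyη : 8 * (H : ℝ) ^ 2 * y ≤ η) (s : Finset ℕ) (x : ℝ) :
    rieszProd a H g (fun _ => y) s x ≤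
      exp (y * cosSum a 1 (s.biUnion (gapBlock H g)) x -
        (1 - η) * (y ^ 2 * (s.biUnion (gapBlock H g)).card / 4)) := by
  have hHR : (1 : ℝ) ≤ H := by exact_mod_cast hH
  set h := H - g with hh
  have hhH : (h : ℝ) ≤ H := by exact_mod_cast Nat.sub_le H g
  have hHy : H * y ≤ 1 := by nlinarith [mul_nonneg (by linarith : (0 : ℝ) ≤ H) hy]
  rw [cosSum_biUnion_gapBlock, card_biUnion_gapBlock, rieszProd]
  have key : ∀ i ∈ s, quadExp (y * cosSum a 1 (gapBlock H g i) x) / (1 + y ^ 2 * h / 4) ≤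
      exp (y * cosSum a 1 (gapBlock H g i) x - (1 - η) * (y ^ 2 * h / 4)) := fun i _ => by
    have e1 : y * cosSum a 1 (gapBlock H g i) x = cosSum a (fun _ => y) (gapBlock H g i) x := by
      simp [cosSum, Finset.mul_sum]
    have hcard : (gapBlock H g i).card ≤ H := (card_gapBlock H g i).le.trans (Nat.sub_le _ _)
    have hc : ∀ k ∈ gapBlock H g i, |(fun _ => y) k| ≤ y := fun _ _ => (abs_of_nonneg hy).le
    have h1 := abs_cosSum_pow_three_le a hy hcard hc x
    have h2 := (abs_cosSum_le_card_mul a hy hcard hc x).trans hHy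
    rw [← e1] at h1 h2
    simp only [Finset.sum_const, card_gapBlock, nsmul_eq_mul, ← hh] at h1
    set u := y * cosSum a 1 (gapBlock H g i) x
    set z := y ^ 2 * (h : ℝ) / 4 with hz
    have hz0 : 0 ≤ z := by positivity
    have h3 : 1 ≤ (1 + z) * exp (z ^ 2 - z) := by
      have := add_one_le_exp (z ^ 2 - z)
      calc 1 ≤ 1 + z ^ 3 := by linarith [pow_nonneg hz0 3]
        _ = (1 + z) * (z ^ 2 - z + 1) := by ring
        _ ≤ _ := by gcongr
    rw [div_le_iff₀ (by positivity)]
    have hzle : z ≤ 4 * (H : ℝ) ^ 2 * y := by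
      rw [hz]
      have : y ^ 2 * h ≤ (H * y) * y := by nlinarith [mul_nonneg hy hy]
      nlinarith
    have herr : |u| ^ 3 + z ^ 2 ≤ η * z := by
      have a1 : |u| ^ 3 ≤ (4 * (H : ℝ) ^ 2 * y) * z := by
        refine h1.trans (le_of_eq ?_); rw [hz]; ring
      nlinarith
    calc quadExp u ≤ exp (u + |u| ^ 3) := quadExp_le_exp h2
      _ ≤ exp (u + |u| ^ 3) * ((1 + z) * exp (z ^ 2 - z)) :=
        le_mul_of_one_le_right (exp_pos _).le h3
      _ = exp (u + (|u| ^ 3 + z ^ 2) - z) * (1 + z) := by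
        rw [mul_comm (1 + z), ← mul_assoc, ← exp_add]; ring_nf
      _ ≤ exp (u - (1 - η) * z) * (1 + z) := by
        exact mul_le_mul_of_nonneg_right (exp_le_exp.2 (by linarith)) (by positivity)
  refine (Finset.prod_le_prod (fun i _ => (div_pos (quadExp_pos _) (by positivity)).le) key).trans
    (le_of_eq ?_)
  rw [← exp_sum, Finset.sum_sub_distrib, Finset.mul_sum]
  simp only [Finset.sum_const, nsmul_eq_mul, ← hh]
  push_cast
  ring_nf

/-- The set where the partial sums over `K` and `I` both have the size that is typical under the
Riesz product with weight `y`. -/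
def tiltSet (a : ℕ → ℕ) (δ y : ℝ) (K I : Finset ℕ) : Set ℝ :=
  {x | cosSum a 1 K x ≤ (1 + δ) * (y * K.card / 2) ∧ (1 - δ) * (y * K.card / 2) ≤ cosSum a 1 I x}

lemma measurableSet_tiltSet (a : ℕ → ℕ) (δ y : ℝ) (K I : Finset ℕ) :
    MeasurableSet (tiltSet a δ y K I) :=
  (measurableSet_le (continuous_cosSum _ _ _).measurable measurable_const).inter
    (measurableSet_le measurable_const (continuous_cosSum _ _ _).measurable)

lemma tilt_upper_exponent_le {δ : ℝ} (h0 : 0 ≤ δ) (h1 : δ ≤ 1) :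
    -(1 - δ ^ 2 / 20) - 2 * δ * (1 + δ) + (1 + δ ^ 2 / 20) * (1 + δ) ^ 2 ≤ -(δ ^ 2 / 4) := by
  have : δ ^ 2 * (1 + δ) ^ 2 ≤ δ ^ 2 * 4 :=
    mul_le_mul_of_nonneg_left (by nlinarith) (sq_nonneg δ)
  linarith [sq_nonneg δ]

lemma tilt_lower_exponent_le {δ : ℝ} (h0 : 0 ≤ δ) (h1 : δ ≤ 1) :
    -(1 - δ ^ 2 / 20) + 2 * δ * (1 - δ) + (1 + δ ^ 2 / 20) * ((1 - δ) ^ 2 + δ ^ 2 / 2) ≤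
      -(δ ^ 2 / 4) := by
  have : δ ^ 2 * ((1 - δ) ^ 2 + δ ^ 2 / 2) ≤ δ ^ 2 * 2 :=
    mul_le_mul_of_nonneg_left (by nlinarith) (sq_nonneg δ)
  linarith [sq_nonneg δ]

theorem Lacunary.one_sub_le_integral_indicator_rieszProd {q : ℝ} {a : ℕ → ℕ} (ha : Lacunary q a)
    {g : ℕ} (hg : 4 < q ^ g * (1 - 1 / q)) {H : ℕ} (hH : 0 < H) {δ b : ℝ} (hδ0 : 0 < δ)
    (hδ1 : δ ≤ 1) (hsub : SubGaussianBelow a (δ ^ 2 / 20) b) {y : ℝ} (hy : 0 ≤ y)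
    (hyb : 2 * y ≤ b) (hyδ : 8 * (H : ℝ) ^ 2 * y ≤ δ ^ 2 / 20) (s I : Finset ℕ)
    {K : Finset ℕ} (hK : K = s.biUnion (gapBlock H g)) (hKI : K ⊆ I)
    (hcard : 2 * I.card ≤ 3 * K.card) :
    1 - 2 * exp (-(y ^ 2 * K.card / 4 * (δ ^ 2 / 4))) ≤
      ∫ x, (tiltSet a δ y K I).indicator (rieszProd a H g (fun _ => y) s) x ∂unitMeasure := by
  set η := δ ^ 2 / 20 with hη
  have hη1 : η ≤ 1 := by rw [hη]; nlinarith
  have hη0 : 0 ≤ η := by positivity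
  set R := rieszProd a H g (fun _ => y) s
  set E := tiltSet a δ y K I
  set Q := y ^ 2 * (K.card : ℝ) / 4 with hQ
  have hQ0 : 0 ≤ Q := by positivity
  set c : ℕ → ℝ := fun k => if k ∈ K then (1 - δ) * y else -(δ * y) with hc
  have hRc : Continuous R := continuous_rieszProd _ _ _ _ _
  have hcsum : ∀ x, cosSum a c I x = y * cosSum a 1 K x - δ * y * cosSum a 1 I x := fun x => by
    have e : ∀ k, c k = (if k ∈ K then y else 0) - δ * y := fun k => by
      simp only [hc]; split_ifs <;> ring
    simp only [cosSum, e, sub_mul, Finset.sum_sub_distrib, ite_mul, zero_mul, Pi.one_apply,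
      one_mul]
    rw [Finset.sum_ite_mem, Finset.inter_eq_right.2 hKI]
    simp only [Finset.mul_sum]
  have hcsq : ∑ k ∈ I, c k ^ 2 = (1 - δ) ^ 2 * y ^ 2 * K.card +
      δ ^ 2 * y ^ 2 * (I.card - K.card) := by
    have e : ∀ k, c k ^ 2 = δ ^ 2 * y ^ 2 +
        if k ∈ K then (1 - δ) ^ 2 * y ^ 2 - δ ^ 2 * y ^ 2 else 0 := fun k => by
      simp only [hc]; split_ifs <;> ring
    simp only [e, Finset.sum_add_distrib]
    rw [Finset.sum_ite_mem, Finset.inter_eq_right.2 hKI]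
    simp only [Finset.sum_const, nsmul_eq_mul]
    ring
  have hcb : ∀ k ∈ I, |c k| ≤ b := fun k _ => by
    refine le_trans ?_ hyb
    have := mul_nonneg hδ0.le hy
    simp only [hc]
    split_ifs
    · rw [abs_le]; constructor <;> nlinarith
    · rw [abs_le]; constructor <;> nlinarith
  have h1 := hsub c I hcb
  have h2 := hsub.integral_exp_const_mul_le (y := (1 + δ) * y)
    (by rw [abs_of_nonneg (by positivity)]; nlinarith) K
  have hcardR : (2 : ℝ) * I.card ≤ 3 * K.card := by exact_mod_cast hcard
  set A₁ := fun x => exp ((1 + δ) * y * cosSum a 1 K x)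
  set A₂ := fun x => exp (cosSum a c I x)
  have hA₁ : Integrable A₁ unitMeasure := Continuous.integrable_unitMeasure
    (continuous_exp.comp ((continuous_cosSum _ _ _).const_mul _))
  have hA₂ : Integrable A₂ unitMeasure := Continuous.integrable_unitMeasure
    (continuous_exp.comp (continuous_cosSum _ _ _))
  set C₁ := exp (-(1 - η) * Q - 2 * δ * (1 + δ) * Q)
  set C₂ := exp (-(1 - η) * Q + 2 * δ * (1 - δ) * Q)
  have hpt : ∀ x, R x - (C₁ * A₁ x + C₂ * A₂ x) ≤ E.indicator R x := fun x => by
    have hR0 : 0 < R x := rieszProd_pos _ _ _ _ _ _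
    have hRle : R x ≤ exp (y * cosSum a 1 K x - (1 - η) * Q) := by
      have := rieszProd_le_exp a (g := g) hH hy hη1 hyδ s x
      rwa [← hK] at this
    have p1 : 0 < C₁ * A₁ x := by positivity
    have p2 : 0 < C₂ * A₂ x := by positivity
    by_cases hx : x ∈ E
    · rw [Set.indicator_of_mem hx]; linarith
    · rw [Set.indicator_of_notMem hx]
      have hx' : ¬(_ ∧ _) := hx
      rw [not_and_or, not_le, not_le] at hx'
      rcases hx' with hx' | hx'
      · have : R x ≤ C₁ * A₁ x := by
          refine hRle.trans ?_
          simp only [C₁, A₁]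
          rw [← exp_add, exp_le_exp]
          have := mul_le_mul_of_nonneg_left hx'.le (mul_nonneg hδ0.le hy)
          have e : δ * y * ((1 + δ) * (y * K.card / 2)) = 2 * δ * (1 + δ) * Q := by
            rw [hQ]; ring
          linarith
        linarith
      · have : R x ≤ C₂ * A₂ x := by
          refine hRle.trans ?_
          simp only [C₂, A₂]
          rw [← exp_add, exp_le_exp, hcsum]
          have := mul_le_mul_of_nonneg_left hx'.le (mul_nonneg hδ0.le hy)
          have e : δ * y * ((1 - δ) * (y * K.card / 2)) = 2 * δ * (1 - δ) * Q := by
            rw [hQ]; ring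
          linarith
        linarith
  have hCA : Integrable (fun x => C₁ * A₁ x + C₂ * A₂ x) unitMeasure :=
    (hA₁.const_mul C₁).add (hA₂.const_mul C₂)
  have hmono := integral_mono (hRc.integrable_unitMeasure.sub hCA)
    (hRc.integrable_unitMeasure.indicator (measurableSet_tiltSet a δ y K I)) hpt
  simp only [Pi.sub_apply] at hmono
  rw [integral_sub hRc.integrable_unitMeasure hCA,
    integral_add (hA₁.const_mul C₁) (hA₂.const_mul C₂), integral_const_mul, integral_const_mul,
    ha.integral_rieszProd hg] at hmono
  refine le_trans ?_ hmono
  have b1 : C₁ * ∫ x, A₁ x ∂unitMeasure ≤ exp (-(Q * (δ ^ 2 / 4))) := by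
    calc _ ≤ C₁ * exp ((1 + η) / 4 * (((1 + δ) * y) ^ 2 * K.card)) :=
          mul_le_mul_of_nonneg_left h2 (exp_pos _).le
      _ ≤ _ := by
        simp only [C₁]
        rw [← exp_add, exp_le_exp]
        have e : (1 + η) / 4 * (((1 + δ) * y) ^ 2 * K.card) = (1 + η) * (1 + δ) ^ 2 * Q := by
          rw [hQ]; ring
        rw [e]
        have := mul_le_mul_of_nonneg_right (tilt_upper_exponent_le hδ0.le hδ1) hQ0
        rw [← hη] at this
        linarith
  have b2 : C₂ * ∫ x, A₂ x ∂unitMeasure ≤ exp (-(Q * (δ ^ 2 / 4))) := by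
    calc _ ≤ C₂ * exp ((1 + η) / 4 * ∑ k ∈ I, c k ^ 2) :=
          mul_le_mul_of_nonneg_left h1 (exp_pos _).le
      _ ≤ _ := by
        simp only [C₂]
        rw [← exp_add, exp_le_exp, hcsq]
        have e : (1 - δ) ^ 2 * y ^ 2 * K.card + δ ^ 2 * y ^ 2 * (I.card - K.card) ≤
            4 * ((1 - δ) ^ 2 + δ ^ 2 / 2) * Q := by
          have : δ ^ 2 * y ^ 2 * ((I.card : ℝ) - K.card) ≤ δ ^ 2 * y ^ 2 * (K.card / 2) :=
            mul_le_mul_of_nonneg_left (by linarith) (by positivity)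
          rw [hQ]; linarith
        have e2 : (1 + η) / 4 * ((1 - δ) ^ 2 * y ^ 2 * K.card +
            δ ^ 2 * y ^ 2 * (I.card - K.card)) ≤ (1 + η) * ((1 - δ) ^ 2 + δ ^ 2 / 2) * Q := by
          calc _ ≤ (1 + η) / 4 * (4 * ((1 - δ) ^ 2 + δ ^ 2 / 2) * Q) :=
                mul_le_mul_of_nonneg_left e (by positivity)
            _ = _ := by ring
        have := mul_le_mul_of_nonneg_right (tilt_lower_exponent_le hδ0.le hδ1) hQ0
        rw [← hη] at this
        linarith
  linarith

lemma indicator_rieszProd_sq_le (a : ℕ → ℕ) {g H : ℕ} (hH : 0 < H) {δ η y : ℝ} (hy : 0 ≤ y)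
    (hη : η ≤ 1) (hyη : 8 * (H : ℝ) ^ 2 * y ≤ η) (s I : Finset ℕ) {K : Finset ℕ}
    (hK : K = s.biUnion (gapBlock H g)) (x : ℝ) :
    (tiltSet a δ y K I).indicator (rieszProd a H g (fun _ => y) s) x *
      (tiltSet a δ y K I).indicator (rieszProd a H g (fun _ => y) s) x ≤
      exp (y ^ 2 * K.card / 4 * (1 + 2 * δ + η)) * rieszProd a H g (fun _ => y) s x := by
  have hR0 : 0 < rieszProd a H g (fun _ => y) s x := rieszProd_pos _ _ _ _ _ _
  by_cases hx : x ∈ tiltSet a δ y K I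
  · rw [Set.indicator_of_mem hx]
    refine mul_le_mul_of_nonneg_right ?_ hR0.le
    refine (rieszProd_le_exp a hH hy hη hyη s x).trans (exp_le_exp.2 ?_)
    rw [← hK]
    have := mul_le_mul_of_nonneg_left hx.1 hy
    linarith
  · rw [Set.indicator_of_notMem hx, zero_mul]
    positivity

lemma tendsto_log_log_natCast : Tendsto (fun N : ℕ => log (log N)) atTop atTop :=
  tendsto_log_atTop.comp (tendsto_log_atTop.comp tendsto_natCast_atTop_atTop)

lemma tendsto_exp_neg_mul_log {c : ℝ} (hc : 0 < c) :
    Tendsto (fun m : ℕ => exp (-(c * log m))) atTop (nhds 0) :=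
  tendsto_exp_neg_atTop_nhds_zero.comp
    ((tendsto_log_atTop.comp tendsto_natCast_atTop_atTop).const_mul_atTop hc)

lemma disjoint_Ico_pow {t m l : ℕ} (ht : 1 ≤ t) (hml : m ≠ l) :
    Disjoint (Finset.Ico (t ^ m) (t ^ (m + 1))) (Finset.Ico (t ^ l) (t ^ (l + 1))) := by
  rw [← Finset.disjoint_coe, Finset.coe_Ico, Finset.coe_Ico]
  exact (pow_right_mono₀ ht).pairwise_disjoint_on_Ico_succ hml

lemma biUnion_gapBlock_Ico_subset_range (H g u v : ℕ) :
    (Finset.Ico u v).biUnion (gapBlock H g) ⊆ Finset.range (v * H) := by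
  intro k hk
  rw [Finset.mem_biUnion] at hk
  obtain ⟨i, hi, hk⟩ := hk
  rw [gapBlock, Finset.mem_Ico] at hk
  rw [Finset.mem_range]
  have : (i + 1) * H ≤ v * H := Nat.mul_le_mul_right _ (Finset.mem_Ico.1 hi).2
  omega

lemma card_biUnion_gapBlock_Ico_pow {t g : ℕ} (ht : 1 ≤ t) (m : ℕ) :
    ((((Finset.Ico (t ^ m) (t ^ (m + 1))).biUnion (gapBlock (g * t) g)).card : ℕ) : ℝ) =
      t ^ m * g * (t - 1) ^ 2 := by
  rw [card_biUnion_gapBlock, Nat.card_Ico, Nat.cast_mul,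
    Nat.cast_sub (Nat.pow_le_pow_right ht (Nat.le_add_right m 1)),
    Nat.cast_sub (Nat.le_mul_of_pos_right g ht)]
  push_cast
  ring

/-- Lower half of the law of the iterated logarithm. -/
theorem Lacunary.ae_frequently_le {q : ℝ} {a : ℕ → ℕ} (ha : Lacunary q a) {ε : ℝ}
    (hε : 0 < ε) : ∀ᵐ x ∂unitMeasure, ∃ᶠ N : ℕ in atTop,
      (1 - ε) * √(N * log (log N)) ≤ cosSum a 1 (Finset.range N) x := by
  set δ := min ε 1 / 5 with hδ
  have hδ0 : 0 < δ := by positivity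
  have hδε : 5 * δ ≤ ε := by rw [hδ]; linarith [min_le_left ε 1]
  have hδ1 : 5 * δ ≤ 1 := by rw [hδ]; linarith [min_le_right ε 1]
  obtain ⟨g, hg0, hg⟩ := ha.exists_gap
  obtain ⟨b, hb0, hsub⟩ := ha.integral_exp_cosSum_le (ε := δ ^ 2 / 20) (by positivity)
  obtain ⟨t, ht⟩ := exists_nat_ge (2 / δ)
  have htδ : 2 ≤ δ * t := by rwa [div_le_iff₀' hδ0] at ht
  have ht10 : (10 : ℝ) ≤ t := by nlinarith
  have ht10' : 10 ≤ t := by exact_mod_cast ht10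
  have ht1 : 1 ≤ t := by omega
  have hgR : (1 : ℝ) ≤ g := by exact_mod_cast hg0
  set H := g * t with hH
  have hH0 : 0 < H := by positivity
  set s : ℕ → Finset ℕ := fun m => Finset.Ico (t ^ m) (t ^ (m + 1)) with hs
  set K : ℕ → Finset ℕ := fun m => (s m).biUnion (gapBlock H g) with hK
  set N : ℕ → ℕ := fun m => t ^ (m + 1) * H with hN
  have hL : ∀ m, ((K m).card : ℝ) = t ^ m * g * (t - 1) ^ 2 :=
    card_biUnion_gapBlock_Ico_pow ht1
  have hNR : ∀ m, (N m : ℝ) = t ^ m * g * t ^ 2 := fun m => by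
    simp only [hN, hH]; push_cast; ring
  have hLN : ∀ m, (1 - δ) * N m ≤ (K m).card := fun m => by
    rw [hL, hNR, mul_comm, mul_assoc]
    refine mul_le_mul_of_nonneg_left ?_ (by positivity)
    nlinarith
  have hL2 : ∀ m, (2 : ℝ) ^ m ≤ (K m).card := fun m => by
    rw [hL]
    calc (2 : ℝ) ^ m ≤ t ^ m := by gcongr; linarith
      _ ≤ t ^ m * (g * (t - 1) ^ 2) := le_mul_of_one_le_right (by positivity) (by nlinarith)
      _ = _ := by ring
  have hL0 : ∀ m, (0 : ℝ) < (K m).card := fun m => lt_of_lt_of_le (by positivity) (hL2 m)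
  have hcard : ∀ m, 2 * (Finset.range (N m)).card ≤ 3 * (K m).card := fun m => by
    rw [Finset.card_range]
    have : (2 : ℝ) * N m ≤ 3 * (K m).card := by
      have : (0 : ℝ) ≤ N m := Nat.cast_nonneg _
      nlinarith [hLN m]
    exact_mod_cast this
  have hKN : ∀ m, K m ⊆ Finset.range (N m) := fun m => biUnion_gapBlock_Ico_subset_range _ _ _ _
  set A : ℕ → ℝ := fun m => (1 - 3 * δ) * log m with hA
  have hA0 : ∀ m, 0 ≤ A m := fun m => mul_nonneg (by linarith) (log_natCast_nonneg m)
  set y : ℕ → ℝ := fun m => 2 * √(A m / (K m).card) with hy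
  have hy0 : ∀ m, 0 ≤ y m := fun m => by positivity
  have hyQ : ∀ m, y m ^ 2 * (K m).card / 4 = A m := fun m => by
    simp only [hy]
    rw [mul_pow, Real.sq_sqrt (div_nonneg (hA0 m) (hL0 m).le)]
    have := (hL0 m).ne'
    field_simp
    ring
  have hyle : ∀ c > 0, ∀ᶠ m in atTop, y m ≤ c := fun c hc => by
    filter_upwards [eventually_two_mul_sqrt_log_div_le hc] with m hm
    refine le_trans ?_ hm
    have : A m ≤ log m := mul_le_of_le_one_left (log_natCast_nonneg m) (by linarith)
    have h1 : A m / (K m).card ≤ log m / 2 ^ m :=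
      div_le_div₀ (log_natCast_nonneg m) this (by positivity) (hL2 m)
    simp only [hy]
    gcongr
  obtain ⟨m₀, hm₀⟩ := eventually_atTop.1 ((hyle (b / 2) (by positivity)).and
    ((hyle (δ ^ 2 / 20 / (8 * (H : ℝ) ^ 2)) (by positivity)).and (eventually_ge_atTop 1)))
  have hyb : ∀ m ≥ m₀, 2 * y m ≤ b := fun m hm => by linarith [(hm₀ m hm).1]
  have hyδ : ∀ m ≥ m₀, 8 * (H : ℝ) ^ 2 * y m ≤ δ ^ 2 / 20 := fun m hm => by
    have := (hm₀ m hm).2.1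
    rwa [le_div_iff₀' (by positivity)] at this
  have hδ20 : δ ^ 2 / 20 ≤ 1 := by nlinarith
  set R : ℕ → ℝ → ℝ := fun m => rieszProd a H g (fun _ => y m) (s m) with hR
  set E : ℕ → Set ℝ := fun m => tiltSet a δ (y m) (K m) (Finset.range (N m)) with hE
  have hRc : ∀ m, Continuous (R m) := fun m => continuous_rieszProd _ _ _ _ _
  have hR0 : ∀ m x, 0 ≤ R m x := fun m x => (rieszProd_pos _ _ _ _ _ _).le
  have hEm : ∀ m, MeasurableSet (E m) := fun m => measurableSet_tiltSet _ _ _ _ _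
  have hUint : ∀ m, Integrable ((E m).indicator (R m)) unitMeasure := fun m =>
    (hRc m).integrable_unitMeasure.indicator (hEm m)
  have hUint2 : ∀ m l, Integrable (fun x => (E m).indicator (R m) x * (E l).indicator (R l) x)
      unitMeasure := fun m l => by
    simp only [← Set.inter_indicator_mul]
    exact ((hRc m).mul (hRc l)).integrable_unitMeasure.indicator ((hEm m).inter (hEm l))
  have hmoment := ae_frequently_ne_zero_of_second_moment (μ := unitMeasure)
    (U := fun m => (E (m + m₀)).indicator (R (m + m₀)))
    (d := fun m => 2 * exp (-(A (m + m₀) * (δ ^ 2 / 4))))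
    (b := fun m => exp (A (m + m₀) * (1 + 2 * δ + δ ^ 2 / 20)))
    (fun m => (hRc _).measurable.indicator (hEm _)) (fun m => hUint _)
    (fun m l => hUint2 _ _)
    (by
      have h := (tendsto_exp_neg_mul_log (c := (1 - 3 * δ) * (δ ^ 2 / 4))
        (mul_pos (by linarith) (by positivity))).const_mul 2
      rw [mul_zero] at h
      refine ((tendsto_add_atTop_iff_nat m₀).2 h).congr fun m => ?_
      simp only [hA]
      ring_nf)
    (fun m => by
      have hm : m₀ ≤ m + m₀ := by omega
      have := ha.one_sub_le_integral_indicator_rieszProd hg hH0 hδ0 (by linarith) hsub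
        (hy0 (m + m₀)) (hyb _ hm) (hyδ _ hm) (s (m + m₀)) (Finset.range (N (m + m₀)))
        (K := K (m + m₀)) rfl (hKN _) (hcard _)
      rwa [hyQ] at this)
    (fun m l hml => by
      rw [← ha.integral_rieszProd_mul hg H (y (m + m₀)) (y (l + m₀))
        (disjoint_Ico_pow ht1 (m := m + m₀) (l := l + m₀) (by omega))]
      refine integral_mono (hUint2 _ _) ((hRc (m + m₀)).mul (hRc (l + m₀))).integrable_unitMeasure
        fun x => ?_
      exact mul_le_mul (Set.indicator_le_self' (fun _ _ => hR0 _ _) x)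
        (Set.indicator_le_self' (fun _ _ => hR0 _ _) x)
        (Set.indicator_nonneg (fun _ _ => hR0 _ _) x) (hR0 _ _))
    (fun m => (exp_pos _).le)
    (fun m => by
      have hm : m₀ ≤ m + m₀ := by omega
      have h := integral_mono (hUint2 (m + m₀) (m + m₀))
        ((hRc (m + m₀)).integrable_unitMeasure.const_mul _) fun x =>
          indicator_rieszProd_sq_le a (δ := δ) hH0 (hy0 (m + m₀)) hδ20 (hyδ _ hm) (s (m + m₀))
            (Finset.range (N (m + m₀))) (K := K (m + m₀)) rfl x
      rwa [integral_const_mul, ha.integral_rieszProd hg, mul_one, hyQ] at h)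
    (by
      have h := (tendsto_exp_neg_mul_log hδ0).const_mul ((m₀ : ℝ) + 1)
      rw [mul_zero] at h
      refine squeeze_zero (fun m => by positivity) (fun m => ?_)
        ((tendsto_add_atTop_iff_nat m₀).2 h)
      have hm1 : 1 ≤ m + m₀ := (hm₀ (m + m₀) (by omega)).2.2
      have hm1' : (0 : ℝ) < (m + m₀ : ℕ) := by exact_mod_cast hm1
      have h1 : A (m + m₀) * (1 + 2 * δ + δ ^ 2 / 20) ≤
          log (m + m₀ : ℕ) + -(δ * log (m + m₀ : ℕ)) := by
        have : (1 - 3 * δ) * (1 + 2 * δ + δ ^ 2 / 20) ≤ 1 - δ := by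
          linarith [sq_nonneg δ, pow_pos hδ0 3]
        have := mul_le_mul_of_nonneg_right this (log_natCast_nonneg (m + m₀))
        simp only [hA]
        linarith
      rw [div_le_iff₀ (by positivity)]
      calc _ ≤ exp (log (m + m₀ : ℕ) + -(δ * log (m + m₀ : ℕ))) := exp_le_exp.2 h1
        _ = (m + m₀ : ℕ) * exp (-(δ * log (m + m₀ : ℕ))) := by rw [exp_add, exp_log hm1']
        _ ≤ ((m₀ + 1) * (m + 1)) * exp (-(δ * log (m + m₀ : ℕ))) := by
          gcongr
          push_cast
          nlinarith [mul_nonneg (Nat.cast_nonneg (α := ℝ) m) (Nat.cast_nonneg (α := ℝ) m₀)]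
        _ = _ := by ring)
  have hNtop : Tendsto N atTop atTop := by
    refine tendsto_atTop_mono (fun m => ?_) tendsto_id
    calc m ≤ t ^ m := (Nat.lt_pow_self (by omega)).le
      _ ≤ t ^ (m + 1) := Nat.pow_le_pow_right ht1 (Nat.le_succ m)
      _ ≤ _ := Nat.le_mul_of_pos_right _ hH0
  have hloglog : ∀ᶠ m in atTop, (1 - δ) * log (log (N m)) ≤ log m := by
    set B := log (g * t ^ 2 : ℝ) with hB
    have hB0 : 0 ≤ B := log_nonneg (by nlinarith)
    have ht0 : 0 < log (t : ℝ) := log_pos (by linarith)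
    filter_upwards [eventually_ge_atTop 1,
      (tendsto_log_atTop.comp tendsto_natCast_atTop_atTop).eventually_ge_atTop
        ((1 - δ) * log (log t + B) / δ)] with m hm1 hm
    rw [Function.comp_apply, div_le_iff₀' hδ0] at hm
    have hm1' : (1 : ℝ) ≤ m := by exact_mod_cast hm1
    have h1 : log (N m) = m * log t + B := by
      rw [hNR, mul_assoc, log_mul (by positivity) (by positivity), log_pow]
    have h2 : log (log (N m)) ≤ log m + log (log t + B) := by
      rw [← log_mul (by positivity) (by positivity), h1]
      refine log_le_log (by positivity) ?_
      nlinarith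
    have := mul_le_mul_of_nonneg_left h2 (by linarith : 0 ≤ 1 - δ)
    linarith
  filter_upwards [hmoment] with x hx
  have hshift : Tendsto (fun m => m + m₀) atTop atTop := tendsto_add_atTop_nat m₀
  refine (hNtop.comp hshift).frequently (hx.mp ?_)
  filter_upwards [hshift.eventually hloglog,
    (hNtop.comp hshift).eventually (tendsto_log_log_natCast.eventually_ge_atTop 0)] with m h1 h2 hU
  have hmem : x ∈ E (m + m₀) := Set.mem_of_indicator_ne_zero hU
  rw [Function.comp_apply] at h2 ⊢
  refine le_trans ?_ hmem.2
  set M := m + m₀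
  have hyL : y M * (K M).card / 2 = √(A M * (K M).card) := by
    rw [eq_comm, Real.sqrt_eq_iff_mul_self_eq (mul_nonneg (hA0 M) (hL0 M).le)
      (div_nonneg (mul_nonneg (hy0 M) (hL0 M).le) two_pos.le), ← hyQ M]
    ring
  rw [hyL]
  have hN0 : (0 : ℝ) ≤ N M := Nat.cast_nonneg _
  have hsqrt : (1 - 3 * δ) * √(N M * log (log (N M))) ≤ √(A M * (K M).card) := by
    refine Real.le_sqrt_of_sq_le ?_
    rw [mul_pow, Real.sq_sqrt (mul_nonneg hN0 h2)]
    have h3 : ((1 - δ) * log (log (N M))) * ((1 - δ) * N M) ≤ log M * (K M).card :=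
      mul_le_mul h1 (hLN M) (mul_nonneg (by linarith) hN0) (log_natCast_nonneg M)
    calc (1 - 3 * δ) ^ 2 * (N M * log (log (N M)))
        ≤ (1 - 3 * δ) * (1 - δ) ^ 2 * (N M * log (log (N M))) :=
          mul_le_mul_of_nonneg_right (by nlinarith) (mul_nonneg hN0 h2)
      _ = (1 - 3 * δ) * (((1 - δ) * log (log (N M))) * ((1 - δ) * N M)) := by ring
      _ ≤ (1 - 3 * δ) * (log M * (K M).card) := mul_le_mul_of_nonneg_left h3 (by linarith)
      _ = _ := by simp only [hA]; ring
  calc (1 - ε) * √(N M * log (log (N M)))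
      ≤ (1 - δ) * (1 - 3 * δ) * √(N M * log (log (N M))) :=
        mul_le_mul_of_nonneg_right (by nlinarith) (Real.sqrt_nonneg _)
    _ = (1 - δ) * ((1 - 3 * δ) * √(N M * log (log (N M)))) := by ring
    _ ≤ _ := mul_le_mul_of_nonneg_left hsqrt (by linarith)

lemma limsup_eq_of_eventually_le_of_frequently_le {u : ℕ → ℝ} {c : ℝ} (h0 : ∀ N, 0 ≤ u N)
    (hle : ∀ j : ℕ, ∀ᶠ N in atTop, u N ≤ (1 + 1 / ((j : ℝ) + 1)) * c)
    (hge : ∀ j : ℕ, ∃ᶠ N in atTop, (1 - 1 / ((j : ℝ) + 1)) * c ≤ u N) :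
    limsup u atTop = c := by
  have hbdd : IsBoundedUnder (· ≤ ·) atTop u := ⟨_, hle 0⟩
  have hcobdd : IsCoboundedUnder (· ≤ ·) atTop u :=
    (isBoundedUnder_of ⟨0, h0⟩ : IsBoundedUnder (· ≥ ·) atTop u).isCoboundedUnder_le
  have hlim := tendsto_one_div_add_atTop_nhds_zero_nat (𝕜 := ℝ)
  refine le_antisymm ?_ ?_
  · refine ge_of_tendsto' (f := fun j : ℕ => (1 + 1 / ((j : ℝ) + 1)) * c) (x := atTop)
      (by simpa using (hlim.const_add 1).mul_const c) fun j => limsup_le_of_le hcobdd (hle j)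
  · refine le_of_tendsto' (f := fun j : ℕ => (1 - 1 / ((j : ℝ) + 1)) * c) (x := atTop)
      (by simpa using (hlim.const_sub 1).mul_const c) fun j =>
        le_limsup_of_frequently_le (hge j) hbdd

/-- (Erdős–Gál law of the iterated logarithm) If `(n_k)_{k ≥ 1}` is a sequence of positive
integers with `n_{k+1}/n_k ≥ q > 1`, then for almost every `x ∈ [0,1]`,
`limsup_{N → ∞} |∑_{k=1}^N cos(2π n_k x)| / √(2 N log log N) = 1/√2`. -/
theorem erdos_gal_lil (n : ℕ → ℕ) (q : ℝ) (hq : 1 < q)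
    (hpos : ∀ k, 1 ≤ k → 0 < n k)
    (hgap : ∀ k, 1 ≤ k → q ≤ (n (k + 1) : ℝ) / (n k : ℝ)) :
    ∀ᵐ x ∂(volume.restrict (Set.Icc (0 : ℝ) 1)),
      Filter.limsup
        (fun N : ℕ =>
          |∑ k ∈ Finset.Icc 1 N, Real.cos (2 * Real.pi * (n k : ℝ) * x)|
            / Real.sqrt (2 * N * Real.log (Real.log N)))
        atTop = 1 / Real.sqrt 2 := by
  have ha : Lacunary q (fun k => n (k + 1)) :=
    ⟨hq, fun k => hpos _ (by omega), fun k => by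
      have h := hgap (k + 1) (by omega)
      rwa [le_div_iff₀ (by exact_mod_cast hpos (k + 1) (by omega))] at h⟩
  have hup := ae_all_iff.2 fun j : ℕ => ha.ae_eventually_abs_le (Nat.one_div_pos_of_nat (n := j))
  have hlow := ae_all_iff.2 fun j : ℕ => ha.ae_frequently_le (Nat.one_div_pos_of_nat (n := j))
  filter_upwards [hup, hlow] with x hx1 hx2
  have hsum : ∀ N : ℕ, ∑ k ∈ Finset.Icc 1 N, Real.cos (2 * Real.pi * (n k : ℝ) * x) =
      cosSum (fun k => n (k + 1)) 1 (Finset.range N) x := fun N => by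
    rw [cosSum, Finset.range_eq_Ico, ← Finset.Ico_add_one_right_eq_Icc, Finset.sum_Ico_eq_sum_range]
    simp only [add_tsub_cancel_right, Finset.range_eq_Ico, Pi.one_apply, one_mul, cosMode,
      add_comm 1]
  simp only [hsum]
  have hpos' : ∀ᶠ N : ℕ in atTop, 0 < √(N * log (log N)) := by
    filter_upwards [eventually_gt_atTop 0, tendsto_log_log_natCast.eventually_gt_atTop 0]
      with N h h'
    positivity
  have hsqrt : ∀ N : ℕ, √(2 * N * log (log N)) = √2 * √(N * log (log N)) := fun N => by
    rw [mul_assoc, Real.sqrt_mul zero_le_two]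
  refine limsup_eq_of_eventually_le_of_frequently_le (fun N => by positivity) (fun j => ?_)
    fun j => ?_
  · filter_upwards [hx1 j, hpos'] with N h h'
    rw [hsqrt, div_le_iff₀ (by positivity)]
    refine h.trans (le_of_eq ?_)
    field_simp
  · refine ((hx2 j).and_eventually hpos').mono fun N h => ?_
    obtain ⟨h, h'⟩ := h
    rw [hsqrt, le_div_iff₀ (by positivity)]
    refine le_trans (le_of_eq ?_) (h.trans (le_abs_self _))
    field_simp
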